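/- Assume (H1)–(H3) and let λ̄ be the ergodic constant. For every bounded uniformly continuous v₀ : ℝⁿ×ℝ → ℝ there exists a unique viscosity solution v of v_t + G(x,y,t,D_x v, D_y v) = 0 on ℝⁿ×ℝ×(0,+∞) with v(x,y,0) = v₀(x,y) on ℝⁿ×ℝ, and v is bounded and uniformly continuous on ℝⁿ×ℝ×[0,T] for every T > 0; moreover t⁻¹ v(x,y,t) → −λ̄ as t → +∞, uniformly with respect to (x,y) ∈ ℝⁿ×ℝ. -/

import Mathlib

open MeasureTheory Topology Filter
open scoped RealInnerProductSpace

noncomputable section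

/-- Euclidean space ℝⁿ. -/
abbrev Euc (n : ℕ) := EuclideanSpace ℝ (Fin n)

/-- Hamiltonians G = G(x, y, t, p_x, p_y). -/
abbrev Ham (n : ℕ) := Euc n → ℝ → ℝ → Euc n → ℝ → ℝ

/-- The space of points (x, y, t) ∈ ℝⁿ×ℝ×ℝ. -/
abbrev Dom (n : ℕ) := Euc n × ℝ × ℝ

/-- The space of points ξ = (x, y, t, p_x, p_y). -/
abbrev Xi (n : ℕ) := Euc n × ℝ × ℝ × Euc n × ℝ

/-- The space of points (x, t) ∈ ℝⁿ×ℝ. -/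
abbrev Dom2 (n : ℕ) := Euc n × ℝ

/-- The integer vector k viewed as a point of ℝⁿ. -/
def intVec {n : ℕ} (k : Fin n → ℤ) : Euc n := WithLp.toLp 2 (fun i => (k i : ℝ))

/-- ∂φ/∂t for φ = φ(x,y,t). -/
def pdT {n : ℕ} (φ : Dom n → ℝ) (z : Dom n) : ℝ := fderiv ℝ φ z (0, 0, 1)

/-- ∂φ/∂y for φ = φ(x,y,t). -/
def pdY {n : ℕ} (φ : Dom n → ℝ) (z : Dom n) : ℝ := fderiv ℝ φ z (0, 1, 0)

/-- D_x φ for φ = φ(x,y,t). -/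
def pdX {n : ℕ} (φ : Dom n → ℝ) (z : Dom n) : Euc n :=
  WithLp.toLp 2 (fun i => fderiv ℝ φ z (EuclideanSpace.single i 1, 0, 0))

/-- ∂φ/∂t for φ = φ(x,t). -/
def pdT2 {n : ℕ} (φ : Dom2 n → ℝ) (z : Dom2 n) : ℝ := fderiv ℝ φ z (0, 1)

/-- D_x φ for φ = φ(x,t). -/
def pdX2 {n : ℕ} (φ : Dom2 n → ℝ) (z : Dom2 n) : Euc n :=
  WithLp.toLp 2 (fun i => fderiv ℝ φ z (EuclideanSpace.single i 1, 0))

/-- Viscosity subsolution of `w_t + G(x,y,t,D_x w,D_y w) + α w = λ` on ℝⁿ×ℝ×ℝ. -/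
def ViscSub {n : ℕ} (G : Ham n) (α lam : ℝ) (u : Dom n → ℝ) : Prop :=
  UpperSemicontinuous u ∧
  ∀ φ : Dom n → ℝ, ContDiff ℝ 1 φ → ∀ z : Dom n,
    IsLocalMax (fun w => u w - φ w) z →
    pdT φ z + G z.1 z.2.1 z.2.2 (pdX φ z) (pdY φ z) + α * u z ≤ lam

/-- Viscosity supersolution of `w_t + G(x,y,t,D_x w,D_y w) + α w = λ` on ℝⁿ×ℝ×ℝ. -/
def ViscSuper {n : ℕ} (G : Ham n) (α lam : ℝ) (u : Dom n → ℝ) : Prop :=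
  LowerSemicontinuous u ∧
  ∀ φ : Dom n → ℝ, ContDiff ℝ 1 φ → ∀ z : Dom n,
    IsLocalMin (fun w => u w - φ w) z →
    lam ≤ pdT φ z + G z.1 z.2.1 z.2.2 (pdX φ z) (pdY φ z) + α * u z

/-- Viscosity solution of `w_t + G(x,y,t,D_x w,D_y w) + α w = λ` on ℝⁿ×ℝ×ℝ. -/
def ViscSol {n : ℕ} (G : Ham n) (α lam : ℝ) (u : Dom n → ℝ) : Prop :=
  Continuous u ∧ ViscSub G α lam u ∧ ViscSuper G α lam u

/-- ℤⁿ-periodicity in x, 1-periodicity in y and t. -/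
def STPeriodic {n : ℕ} (u : Dom n → ℝ) : Prop :=
  (∀ (k : Fin n → ℤ) (x : Euc n) (y t : ℝ), u (x + intVec k, y, t) = u (x, y, t)) ∧
  (∀ x y t, u (x, y + 1, t) = u (x, y, t)) ∧
  (∀ x y t, u (x, y, t + 1) = u (x, y, t))

/-- Boundedness of a function on ℝⁿ×ℝ×ℝ. -/
def Bdd {n : ℕ} (u : Dom n → ℝ) : Prop := ∃ M, ∀ z, |u z| ≤ M

/-- (H1) : continuity and periodicity of the Hamiltonian. -/
def HypH1 {n : ℕ} (G : Ham n) : Prop :=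
  Continuous (fun ξ : Xi n => G ξ.1 ξ.2.1 ξ.2.2.1 ξ.2.2.2.1 ξ.2.2.2.2) ∧
  (∀ (k : Fin n → ℤ) x y t px py, G (x + intVec k) y t px py = G x y t px py) ∧
  (∀ x y t px py, G x (y + 1) t px py = G x y t px py) ∧
  (∀ x y t px py, G x y (t + 1) px py = G x y t px py)

/-- (H2) : coercivity in p_x at p_y = 0, with constants C₁, C₂ > 0. -/
def HypH2 {n : ℕ} (G : Ham n) (C₁ C₂ : ℝ) : Prop :=
  0 < C₁ ∧ 0 < C₂ ∧ ∀ x y t px, C₁ * ‖px‖ - C₂ ≤ G x y t px 0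

/-- (H2') : coercivity in p_x, locally uniformly in p_y. -/
def HypH2' {n : ℕ} (F : Ham n) : Prop :=
  ∀ R : ℝ, 0 < R → ∃ C₁ C₂ : ℝ, 0 < C₁ ∧ 0 < C₂ ∧
    ∀ x y t px py, |py| ≤ R → C₁ * ‖px‖ - C₂ ≤ F x y t px py

/-- (H3) : local Lipschitz continuity in (y,t,p_y) and a.e. bounds on the
partial derivatives ∂_y G, ∂_t G, ∂_{p_y} G. -/
def HypH3 {n : ℕ} (G : Ham n) (l C₃ C₄ C₅ : ℝ) : Prop :=
  0 ≤ C₃ ∧ 0 ≤ C₄ ∧ 0 ≤ C₅ ∧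
  (∀ (x px : Euc n), LocallyLipschitz (fun q : ℝ × ℝ × ℝ => G x q.1 q.2.1 px q.2.2)) ∧
  (∀ᵐ ξ ∂(volume : Measure (Xi n)),
    |deriv (fun y => G ξ.1 y ξ.2.2.1 ξ.2.2.2.1 ξ.2.2.2.2) ξ.2.1| ≤ C₃ * |ξ.2.2.2.2 + l| ∧
    |deriv (fun t => G ξ.1 ξ.2.1 t ξ.2.2.2.1 ξ.2.2.2.2) ξ.2.2.1| ≤
      C₄ * (1 + |ξ.2.2.2.2| + |G ξ.1 ξ.2.1 ξ.2.2.1 ξ.2.2.2.1 ξ.2.2.2.2|) ∧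
    |deriv (fun py => G ξ.1 ξ.2.1 ξ.2.2.1 ξ.2.2.2.1 py) ξ.2.2.2.2| ≤ C₅)

/-- λ is an ergodic constant : bounded usc subsolution and bounded lsc
supersolution of `w_t + G = λ` exist. -/
def ErgodicConst {n : ℕ} (G : Ham n) (lam : ℝ) : Prop :=
  (∃ u, Bdd u ∧ ViscSub G 0 lam u) ∧ (∃ v, Bdd v ∧ ViscSuper G 0 lam v)

/-- λ solves the cell problem at (p_x,p_y) : the equation
`v_t + F(x,y,t,p_x + D_x v, p_y + D_y v) = λ` has a bounded space-time periodic
usc subsolution and a bounded space-time periodic lsc supersolution. -/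
def CellOk {n : ℕ} (F : Ham n) (px : Euc n) (py lam : ℝ) : Prop :=
  (∃ u, Bdd u ∧ STPeriodic u ∧
    ViscSub (fun x y t qx qy => F x y t (px + qx) (py + qy)) 0 lam u) ∧
  (∃ v, Bdd v ∧ STPeriodic v ∧
    ViscSuper (fun x y t qx qy => F x y t (px + qx) (py + qy)) 0 lam v)

/-- Viscosity subsolution of `w_t + G(x,y,t,D_x w,D_y w) = 0` on ℝⁿ×ℝ×(0,∞). -/
def ViscSubPos {n : ℕ} (G : Ham n) (u : Dom n → ℝ) : Prop :=
  ∀ φ : Dom n → ℝ, ContDiff ℝ 1 φ → ∀ z : Dom n, 0 < z.2.2 →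
    IsLocalMax (fun w => u w - φ w) z →
    pdT φ z + G z.1 z.2.1 z.2.2 (pdX φ z) (pdY φ z) ≤ 0

/-- Viscosity supersolution of `w_t + G(x,y,t,D_x w,D_y w) = 0` on ℝⁿ×ℝ×(0,∞). -/
def ViscSuperPos {n : ℕ} (G : Ham n) (u : Dom n → ℝ) : Prop :=
  ∀ φ : Dom n → ℝ, ContDiff ℝ 1 φ → ∀ z : Dom n, 0 < z.2.2 →
    IsLocalMin (fun w => u w - φ w) z →
    0 ≤ pdT φ z + G z.1 z.2.1 z.2.2 (pdX φ z) (pdY φ z)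

/-- Bounded uniformly continuous (on every slab ℝⁿ×ℝ×[0,T]) viscosity solution of the
initial value problem `v_t + G(x,y,t,D_x v,D_y v) = 0` on ℝⁿ×ℝ×(0,∞), `v(x,y,0) = v₀(x,y)`. -/
def IVPSol {n : ℕ} (G : Ham n) (v₀ : Dom2 n → ℝ) (v : Dom n → ℝ) : Prop :=
  ContinuousOn v {z : Dom n | 0 ≤ z.2.2} ∧
  (∀ x y, v (x, y, 0) = v₀ (x, y)) ∧
  ViscSubPos G v ∧ ViscSuperPos G v ∧
  (∀ T : ℝ, 0 < T →
    (∃ M, ∀ z : Dom n, 0 ≤ z.2.2 → z.2.2 ≤ T → |v z| ≤ M) ∧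
    UniformContinuousOn v {z : Dom n | 0 ≤ z.2.2 ∧ z.2.2 ≤ T})

/-- Viscosity subsolution of the eikonal-type inequality `w_t + c|D_x w| - C ≤ 0` on ℝⁿ×ℝ. -/
def ViscSubEik {n : ℕ} (c C : ℝ) (u : Dom2 n → ℝ) : Prop :=
  UpperSemicontinuous u ∧
  ∀ φ : Dom2 n → ℝ, ContDiff ℝ 1 φ → ∀ z : Dom2 n,
    IsLocalMax (fun w => u w - φ w) z →
    pdT2 φ z + c * ‖pdX2 φ z‖ - C ≤ 0

section PartA

/-! ### Part A: consequences of (H3) -/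

lemma ae_line {E : Type*} [NormedAddCommGroup E] [NormedSpace ℝ E] [MeasurableSpace E]
    [BorelSpace E] [SecondCountableTopology E] (μ : Measure E) [SFinite μ] [μ.IsAddRightInvariant]
    (e : E) {p : E → Prop} (hp : ∀ᵐ ξ ∂μ, p ξ) :
    ∀ᵐ ξ ∂μ, ∀ᵐ s ∂(volume : Measure ℝ), p (ξ + s • e) := by
  obtain ⟨N, hN, hNm, hN0⟩ := exists_measurable_superset_of_null (ae_iff.1 hp)
  have key : ∀ᵐ ξ ∂μ, ∀ᵐ s ∂(volume : Measure ℝ), ξ + s • e ∉ N := by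
    rw [Measure.ae_ae_comm]
    · refine Eventually.of_forall fun s => ?_
      have : Measure.QuasiMeasurePreserving (fun ξ : E => ξ + s • e) μ μ :=
        (measurePreserving_add_right μ (s • e)).quasiMeasurePreserving
      exact this.ae (show ∀ᵐ x ∂μ, x ∉ N from measure_eq_zero_iff_ae_notMem.1 hN0)
    · have hm : Measurable (fun x : E × ℝ => x.1 + x.2 • e) := by
        apply Continuous.measurable; fun_prop
      exact (hm hNm).compl
  filter_upwards [key] with ξ h
  filter_upwards [h] with s hs
  by_contra hc
  exact hs (hN hc)

lemma lip_of_ae_deriv {f : ℝ → ℝ} (hf : LocallyLipschitz f) (C a b : ℝ)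
    (h : ∀ᵐ s ∂(volume : Measure ℝ), s ∈ Set.uIcc a b → |deriv f s| ≤ C) :
    |f b - f a| ≤ C * |b - a| := by
  obtain ⟨K, hK⟩ := (hf.locallyLipschitzOn (s := Set.uIcc a b)).exists_lipschitzOnWith_of_compact isCompact_uIcc
  have hac := hK.absolutelyContinuousOnInterval
  rw [← hac.integral_deriv_eq_sub, ← Real.norm_eq_abs]
  apply intervalIntegral.norm_integral_le_of_norm_le_const_ae
  filter_upwards [h] with s hs hm
  exact hs (Set.uIoc_subset_uIcc hm)

lemma closed_all {E : Type*} [NormedAddCommGroup E] [MeasurableSpace E] (μ : Measure E) [μ.IsOpenPosMeasure]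
    {f g : E → ℝ} (hf : Continuous f) (hg : Continuous g) (h : ∀ᵐ ξ ∂μ, f ξ ≤ g ξ) : ∀ ξ, f ξ ≤ g ξ := by
  have hd : Dense {ξ | f ξ ≤ g ξ} := Measure.dense_of_ae h
  have hc : IsClosed {ξ | f ξ ≤ g ξ} := isClosed_le hf hg
  intro ξ
  have : ξ ∈ closure {ξ | f ξ ≤ g ξ} := hd ξ
  rwa [hc.closure_eq] at this

variable {n : ℕ}

instance xiHaar : (volume : Measure (Xi n)).IsAddHaarMeasure := by
  have a1 : (volume : Measure (Euc n × ℝ)).IsAddHaarMeasure :=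
    Measure.prod.instIsAddHaarMeasure _ _
  have a2 : (volume : Measure (ℝ × Euc n × ℝ)).IsAddHaarMeasure :=
    Measure.prod.instIsAddHaarMeasure _ _
  have a3 : (volume : Measure (ℝ × ℝ × Euc n × ℝ)).IsAddHaarMeasure :=
    Measure.prod.instIsAddHaarMeasure _ _
  exact Measure.prod.instIsAddHaarMeasure _ _

lemma G_lip_y {G : Ham n} {l C₃ C₄ C₅ : ℝ} (h1 : HypH1 G) (h3 : HypH3 G l C₃ C₄ C₅)
    (x : Euc n) (y y' t : ℝ) (px : Euc n) (py : ℝ) :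
    |G x y' t px py - G x y t px py| ≤ C₃ * |py + l| * |y' - y| := by
  obtain ⟨hc, -⟩ := h1
  obtain ⟨-, -, -, hL, hae⟩ := h3
  have hl := ae_line (volume : Measure (Xi n)) (0, 1, 0, 0, 0) hae
  have key := closed_all (volume : Measure (Xi n))
    (f := fun ξ => |G ξ.1 (ξ.2.1 + (y' - y)) ξ.2.2.1 ξ.2.2.2.1 ξ.2.2.2.2
        - G ξ.1 ξ.2.1 ξ.2.2.1 ξ.2.2.2.1 ξ.2.2.2.2|)
    (g := fun ξ => C₃ * |ξ.2.2.2.2 + l| * |y' - y|) ?_ (by fun_prop) ?_ (x, y, t, px, py)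
  · simpa using key
  · exact ((hc.comp (f := fun ξ : Xi n => (ξ.1, ξ.2.1 + (y' - y), ξ.2.2.1, ξ.2.2.2.1, ξ.2.2.2.2))
      (by fun_prop)).sub hc).abs
  · filter_upwards [hl] with ξ hξ
    have hLf : LocallyLipschitz (fun s => G ξ.1 (ξ.2.1 + s) ξ.2.2.1 ξ.2.2.2.1 ξ.2.2.2.2) := by
      refine (hL ξ.1 ξ.2.2.2.1).comp (g := fun s => (ξ.2.1 + s, ξ.2.2.1, ξ.2.2.2.2)) ?_
      apply ContDiff.locallyLipschitz (𝕂 := ℝ); fun_prop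
    have := lip_of_ae_deriv hLf (C₃ * |ξ.2.2.2.2 + l|) 0 (y' - y) ?_
    · simpa using this
    · filter_upwards [hξ] with s hs _
      have := hs.1
      simp only [Prod.fst_add, Prod.snd_add, Prod.smul_mk, smul_zero, add_zero, smul_eq_mul, mul_one, mul_zero, add_zero] at this
      rwa [deriv_comp_const_add (f := fun y => G ξ.1 y ξ.2.2.1 ξ.2.2.2.1 ξ.2.2.2.2)]

lemma G_lip_p {G : Ham n} {l C₃ C₄ C₅ : ℝ} (h1 : HypH1 G) (h3 : HypH3 G l C₃ C₄ C₅)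
    (x : Euc n) (y t : ℝ) (px : Euc n) (py py' : ℝ) :
    |G x y t px py' - G x y t px py| ≤ C₅ * |py' - py| := by
  obtain ⟨hc, -⟩ := h1
  obtain ⟨-, -, -, hL, hae⟩ := h3
  have hl := ae_line (volume : Measure (Xi n)) (0, 0, 0, 0, 1) hae
  have key := closed_all (volume : Measure (Xi n))
    (f := fun ξ => |G ξ.1 ξ.2.1 ξ.2.2.1 ξ.2.2.2.1 (ξ.2.2.2.2 + (py' - py))
        - G ξ.1 ξ.2.1 ξ.2.2.1 ξ.2.2.2.1 ξ.2.2.2.2|)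
    (g := fun ξ => C₅ * |py' - py|) ?_ (by fun_prop) ?_ (x, y, t, px, py)
  · simpa using key
  · exact ((hc.comp (f := fun ξ : Xi n => (ξ.1, ξ.2.1, ξ.2.2.1, ξ.2.2.2.1, ξ.2.2.2.2 + (py' - py)))
      (by fun_prop)).sub hc).abs
  · filter_upwards [hl] with ξ hξ
    have hLf : LocallyLipschitz (fun s => G ξ.1 ξ.2.1 ξ.2.2.1 ξ.2.2.2.1 (ξ.2.2.2.2 + s)) := by
      refine (hL ξ.1 ξ.2.2.2.1).comp (g := fun s => (ξ.2.1, ξ.2.2.1, ξ.2.2.2.2 + s)) ?_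
      apply ContDiff.locallyLipschitz (𝕂 := ℝ); fun_prop
    have := lip_of_ae_deriv hLf C₅ 0 (py' - py) ?_
    · simpa using this
    · filter_upwards [hξ] with s hs _
      have := hs.2.2
      simp only [Prod.fst_add, Prod.snd_add, Prod.smul_mk, smul_zero, add_zero, smul_eq_mul, mul_one, mul_zero, add_zero] at this
      rwa [deriv_comp_const_add (f := fun p => G ξ.1 ξ.2.1 ξ.2.2.1 ξ.2.2.2.1 p)]

lemma gronwall_small {f : ℝ → ℝ} (hf : LocallyLipschitz f) {C A b : ℝ} (hC : 0 ≤ C) (hA : 0 ≤ A)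
    (hb : C * |b| ≤ 1 / 2)
    (h : ∀ᵐ s ∂(volume : Measure ℝ), |deriv f s| ≤ C * (A + |f s|)) :
    |f b - f 0| ≤ 2 * C * (A + |f 0|) * |b| := by
  obtain ⟨m, hm, hmax⟩ := isCompact_uIcc.exists_isMaxOn (s := Set.uIcc 0 b) Set.nonempty_uIcc
    (hf.continuous.abs.continuousOn)
  have h1 : ∀ c ∈ Set.uIcc 0 b, |f c - f 0| ≤ C * (A + |f m|) * |b| := by
    intro c hc
    have h2 := lip_of_ae_deriv hf (C * (A + |f m|)) 0 c (by
      filter_upwards [h] with s hs hsc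
      refine hs.trans ?_
      have : |f s| ≤ |f m| := hmax (Set.uIcc_subset_uIcc_left hc hsc)
      gcongr)
    refine h2.trans ?_
    have : |c - 0| ≤ |b| := by
      have := Set.abs_sub_left_of_mem_uIcc hc
      simpa using this
    gcongr
  have h2 := h1 m hm
  have h3 : |f m| ≤ |f 0| + |f m - f 0| := by
    have := abs_add_le (f 0) (f m - f 0); simpa using this
  have h4 : C * (A + |f m|) * |b| ≤ 1 / 2 * (A + |f m|) := by
    have : 0 ≤ A + |f m| := by positivity
    nlinarith
  have h5 : A + |f m| ≤ 2 * (A + |f 0|) := by linarith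
  refine (h1 b Set.right_mem_uIcc).trans ?_
  have : 2 * C * (A + |f 0|) * |b| = C * (2 * (A + |f 0|)) * |b| := by ring
  rw [this]
  gcongr

lemma G_lip_t {G : Ham n} {l C₃ C₄ C₅ : ℝ} (h1 : HypH1 G) (h3 : HypH3 G l C₃ C₄ C₅)
    (x : Euc n) (y t t' : ℝ) (px : Euc n) (py : ℝ) (ht : C₄ * |t' - t| ≤ 1 / 2) :
    |G x y t' px py - G x y t px py| ≤ 2 * C₄ * (1 + |py| + |G x y t px py|) * |t' - t| := by
  obtain ⟨hc, -⟩ := h1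
  obtain ⟨-, hC4, -, hL, hae⟩ := h3
  have hl := ae_line (volume : Measure (Xi n)) (0, 0, 1, 0, 0) hae
  have key := closed_all (volume : Measure (Xi n))
    (f := fun ξ => |G ξ.1 ξ.2.1 (ξ.2.2.1 + (t' - t)) ξ.2.2.2.1 ξ.2.2.2.2
        - G ξ.1 ξ.2.1 ξ.2.2.1 ξ.2.2.2.1 ξ.2.2.2.2|)
    (g := fun ξ => 2 * C₄ * (1 + |ξ.2.2.2.2| + |G ξ.1 ξ.2.1 ξ.2.2.1 ξ.2.2.2.1 ξ.2.2.2.2|) * |t' - t|)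
      ?_ (by fun_prop) ?_ (x, y, t, px, py)
  · simpa using key
  · exact ((hc.comp (f := fun ξ : Xi n => (ξ.1, ξ.2.1, ξ.2.2.1 + (t' - t), ξ.2.2.2.1, ξ.2.2.2.2))
      (by fun_prop)).sub hc).abs
  · filter_upwards [hl] with ξ hξ
    have hLf : LocallyLipschitz (fun s => G ξ.1 ξ.2.1 (ξ.2.2.1 + s) ξ.2.2.2.1 ξ.2.2.2.2) := by
      refine (hL ξ.1 ξ.2.2.2.1).comp (g := fun s => (ξ.2.1, ξ.2.2.1 + s, ξ.2.2.2.2)) ?_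
      apply ContDiff.locallyLipschitz (𝕂 := ℝ); fun_prop
    have := gronwall_small hLf (C := C₄) (A := 1 + |ξ.2.2.2.2|) hC4 (by positivity) ht ?_
    · simpa using this
    · filter_upwards [hξ] with s hs
      have := hs.2.1
      simp only [Prod.fst_add, Prod.snd_add, Prod.smul_mk, smul_zero, add_zero, smul_eq_mul, mul_one, mul_zero, add_zero] at this
      rwa [deriv_comp_const_add (f := fun t => G ξ.1 ξ.2.1 t ξ.2.2.2.1 ξ.2.2.2.2)]

lemma G_coer {G : Ham n} {C₁ C₂ l C₃ C₄ C₅ : ℝ} (h1 : HypH1 G) (h2 : HypH2 G C₁ C₂)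
    (h3 : HypH3 G l C₃ C₄ C₅) (x : Euc n) (y t : ℝ) (px : Euc n) (py : ℝ) :
    C₁ * ‖px‖ - C₂ - C₅ * |py| ≤ G x y t px py := by
  have a := h2.2.2 x y t px
  have b := G_lip_p h1 h3 x y t px 0 py
  rw [sub_zero] at b
  linarith [(abs_le.1 b).1]

end PartA

section PartB

/-! ### Part B: compactness, derivatives of test functions -/

variable {n : ℕ}

lemma exists_shift (n : ℕ) : ∃ B : ℝ, ∀ x : Euc n, ∃ k : Fin n → ℤ, ‖x + intVec k‖ ≤ B := by
  refine ⟨Real.sqrt n, fun x => ⟨fun i => -⌊x i⌋, ?_⟩⟩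
  rw [EuclideanSpace.norm_eq]
  apply Real.sqrt_le_sqrt
  calc ∑ i, ‖(x + intVec fun i => -⌊x i⌋) i‖ ^ 2 ≤ ∑ i : Fin n, (1 : ℝ) := by
        apply Finset.sum_le_sum
        intro i _
        have : (x + intVec fun i => -⌊x i⌋) i = Int.fract (x i) := by
          simp [intVec, Int.fract, sub_eq_add_neg]
        rw [this, Real.norm_eq_abs, abs_of_nonneg (Int.fract_nonneg _)]
        have h0 := Int.fract_nonneg (x i)
        have h1 := Int.fract_lt_one (x i)
        nlinarith
    _ = n := by simp

lemma G_shift_y {G : Ham n} (h1 : HypH1 G) (x : Euc n) (y t : ℝ) (px : Euc n) (py : ℝ) :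
    G x (Int.fract y) t px py = G x y t px py := by
  have hp : Function.Periodic (fun y => G x y t px py) 1 := fun y => h1.2.2.1 x y t px py
  have := hp.sub_int_mul_eq (x := y) ⌊y⌋
  rw [mul_one] at this
  exact this

lemma G_shift_t {G : Ham n} (h1 : HypH1 G) (x : Euc n) (y t : ℝ) (px : Euc n) (py : ℝ) :
    G x y (Int.fract t) px py = G x y t px py := by
  have hp : Function.Periodic (fun t => G x y t px py) 1 := fun t => h1.2.2.2 x y t px py
  have := hp.sub_int_mul_eq (x := t) ⌊t⌋
  rw [mul_one] at this
  exact this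

def bigK (n : ℕ) (B R : ℝ) : Set (Xi n) :=
  Metric.closedBall 0 B ×ˢ Set.Icc 0 1 ×ˢ Set.Icc 0 1 ×ˢ Metric.closedBall 0 R ×ˢ Metric.closedBall 0 R

lemma bigK_compact (B R : ℝ) : IsCompact (bigK n B R) :=
  (isCompact_closedBall _ _).prod (isCompact_Icc.prod (isCompact_Icc.prod
    ((isCompact_closedBall _ _).prod (isCompact_closedBall _ _))))

lemma fract_mem (y : ℝ) : Int.fract y ∈ Set.Icc (0 : ℝ) 1 :=
  ⟨Int.fract_nonneg _, (Int.fract_lt_one _).le⟩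

lemma G_bdd {G : Ham n} (h1 : HypH1 G) (R : ℝ) : ∃ C : ℝ, ∀ (x : Euc n) (y t : ℝ) (px : Euc n) (py : ℝ),
    ‖px‖ ≤ R → |py| ≤ R → |G x y t px py| ≤ C := by
  obtain ⟨B, hB⟩ := exists_shift n
  obtain ⟨C, hC⟩ := (bigK_compact (n := n) B R).exists_bound_of_continuousOn h1.1.continuousOn
  refine ⟨C, fun x y t px py hpx hpy => ?_⟩
  obtain ⟨k, hk⟩ := hB x
  have := hC (x + intVec k, Int.fract y, Int.fract t, px, py)
    ⟨by simpa using hk, fract_mem y, fract_mem t, by simpa using hpx, by simpa using hpy⟩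
  simpa only [h1.2.1, G_shift_y h1, G_shift_t h1, Real.norm_eq_abs] using this

lemma G_uc {G : Ham n} (h1 : HypH1 G) (R θ : ℝ) (hθ : 0 < θ) : ∃ ω > 0,
    ∀ (x x' : Euc n) (y t : ℝ) (px px' : Euc n) (py py' : ℝ),
    ‖px‖ ≤ R → |py| ≤ R → ‖px'‖ ≤ R → |py'| ≤ R →
    ‖x - x'‖ ≤ ω → ‖px - px'‖ ≤ ω → |py - py'| ≤ ω →
    |G x y t px py - G x' y t px' py'| ≤ θ := by
  obtain ⟨B, hB⟩ := exists_shift n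
  have huc := (bigK_compact (n := n) (B + 1) R).uniformContinuousOn_of_continuous h1.1.continuousOn
  rw [Metric.uniformContinuousOn_iff] at huc
  obtain ⟨ω, hω, h⟩ := huc θ hθ
  refine ⟨min (ω / 2) 1, by positivity, fun x x' y t px px' py py' a1 a2 a3 a4 a5 a6 a7 => ?_⟩
  obtain ⟨k, hk⟩ := hB x
  have hx' : ‖x' + intVec k‖ ≤ B + 1 := by
    have : x' + intVec k = (x + intVec k) - (x - x') := by abel
    rw [this]
    refine (norm_sub_le _ _).trans ?_
    have := a5.trans (min_le_right _ _)
    linarith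
  have := h (x + intVec k, Int.fract y, Int.fract t, px, py)
    ⟨by simpa using hk.trans (by linarith), fract_mem y, fract_mem t, by simpa using a1, by simpa using a2⟩
    (x' + intVec k, Int.fract y, Int.fract t, px', py')
    ⟨by simpa using hx', fract_mem y, fract_mem t, by simpa using a3, by simpa using a4⟩ ?_
  · simp only [h1.2.1, G_shift_y h1, G_shift_t h1, Real.dist_eq] at this
    exact this.le
  · have e5 := a5.trans (min_le_left _ _)
    have e6 := a6.trans (min_le_left _ _)
    have e7 := a7.trans (min_le_left _ _)
    have d1 : dist (x + intVec k) (x' + intVec k) < ω := by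
      rw [dist_add_right, dist_eq_norm]; linarith
    have d2 : dist px px' < ω := by rw [dist_eq_norm]; linarith
    have d3 : dist py py' < ω := by rw [Real.dist_eq]; linarith
    simp only [Prod.dist_eq, dist_self]
    exact max_lt d1 (max_lt hω (max_lt hω (max_lt d2 d3)))

lemma pd_sep {a : Euc n → ℝ} {b d : ℝ → ℝ} {z : Dom n} {px : Euc n} {py pt : ℝ}
    (ha : HasGradientAt a px z.1) (hb : HasDerivAt b py z.2.1) (hd : HasDerivAt d pt z.2.2) :
    HasFDerivAt (fun z : Dom n => a z.1 + b z.2.1 + d z.2.2)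
      (((innerSL ℝ px).comp (ContinuousLinearMap.fst ℝ (Euc n) (ℝ × ℝ)))
      + (py • ((ContinuousLinearMap.fst ℝ ℝ ℝ).comp (ContinuousLinearMap.snd ℝ (Euc n) (ℝ × ℝ))))
      + (pt • ((ContinuousLinearMap.snd ℝ ℝ ℝ).comp (ContinuousLinearMap.snd ℝ (Euc n) (ℝ × ℝ))))) z := by
  have h1 : HasFDerivAt (fun z : Dom n => a z.1) _ z :=
    HasFDerivAt.comp z (hasGradientAt_iff_hasFDerivAt.1 ha) hasFDerivAt_fst
  have hs : HasFDerivAt (Prod.snd : Dom n → ℝ × ℝ) (ContinuousLinearMap.snd ℝ (Euc n) (ℝ × ℝ)) z :=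
    hasFDerivAt_snd
  have h2 : HasFDerivAt (fun z : Dom n => b z.2.1) _ z :=
    hb.comp_hasFDerivAt z (HasFDerivAt.comp z (f := Prod.snd) (g := Prod.fst) hasFDerivAt_fst hs)
  have h3 : HasFDerivAt (fun z : Dom n => d z.2.2) _ z :=
    hd.comp_hasFDerivAt z (HasFDerivAt.comp z (f := Prod.snd) (g := Prod.snd) hasFDerivAt_snd hs)
  exact (h1.add h2).add h3

lemma pd_of_hasFDerivAt {φ : Dom n → ℝ} {z : Dom n} {px : Euc n} {py pt : ℝ}
    (h : HasFDerivAt φ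
      (((innerSL ℝ px).comp (ContinuousLinearMap.fst ℝ (Euc n) (ℝ × ℝ)))
      + (py • ((ContinuousLinearMap.fst ℝ ℝ ℝ).comp (ContinuousLinearMap.snd ℝ (Euc n) (ℝ × ℝ))))
      + (pt • ((ContinuousLinearMap.snd ℝ ℝ ℝ).comp (ContinuousLinearMap.snd ℝ (Euc n) (ℝ × ℝ))))) z) :
    pdX φ z = px ∧ pdY φ z = py ∧ pdT φ z = pt := by
  refine ⟨?_, ?_, ?_⟩
  · ext i
    simp [pdX, h.fderiv, EuclideanSpace.inner_single_right]
  · simp [pdY, h.fderiv]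
  · simp [pdT, h.fderiv]

lemma pd_sep' {a : Euc n → ℝ} {b d : ℝ → ℝ} {z : Dom n} {px : Euc n} {py pt : ℝ}
    (ha : HasGradientAt a px z.1) (hb : HasDerivAt b py z.2.1) (hd : HasDerivAt d pt z.2.2) :
    pdX (fun z : Dom n => a z.1 + b z.2.1 + d z.2.2) z = px ∧
    pdY (fun z : Dom n => a z.1 + b z.2.1 + d z.2.2) z = py ∧
    pdT (fun z : Dom n => a z.1 + b z.2.1 + d z.2.2) z = pt :=
  pd_of_hasFDerivAt (pd_sep ha hb hd)

lemma contDiff_sep {a : Euc n → ℝ} {b d : ℝ → ℝ} (ha : ContDiff ℝ 1 a) (hb : ContDiff ℝ 1 b)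
    (hd : ContDiff ℝ 1 d) : ContDiff ℝ 1 (fun z : Dom n => a z.1 + b z.2.1 + d z.2.2) := by
  fun_prop

/-- logarithmic penalisation on the line -/
def Lg (s : ℝ) : ℝ := Real.log (1 + s ^ 2)

/-- logarithmic penalisation on Euclidean space -/
def LgE (x : Euc n) : ℝ := Real.log (1 + ‖x‖ ^ 2)

lemma Lg_nonneg (s : ℝ) : 0 ≤ Lg s := Real.log_nonneg (by nlinarith [sq_nonneg s])
lemma LgE_nonneg (x : Euc n) : 0 ≤ LgE x := Real.log_nonneg (by nlinarith [sq_nonneg ‖x‖])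

lemma Lg_contDiff : ContDiff ℝ 1 Lg := by
  unfold Lg
  apply ContDiff.log
  · fun_prop
  · intro x; positivity

lemma LgE_contDiff : ContDiff ℝ 1 (LgE (n := n)) := by
  unfold LgE
  apply ContDiff.log
  · exact contDiff_const.add (contDiff_norm_sq ℝ)
  · intro x; positivity

lemma Lg_bound {s B : ℝ} (hB : 0 ≤ B) (h : Lg s ≤ B) : |s| ≤ Real.exp B := by
  have h1 : 1 + s ^ 2 ≤ Real.exp B := (Real.log_le_iff_le_exp (by positivity)).1 h
  have h2 := Real.one_le_exp hB
  have h3 := Real.exp_pos B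
  refine abs_le_of_sq_le_sq ?_ h3.le
  nlinarith

lemma LgE_bound {x : Euc n} {B : ℝ} (hB : 0 ≤ B) (h : LgE x ≤ B) : ‖x‖ ≤ Real.exp B := by
  have h1 : Lg ‖x‖ ≤ B := h
  simpa using Lg_bound hB h1

/-- derivative of `Lg` -/
def dLg (s : ℝ) : ℝ := 2 * s / (1 + s ^ 2)

/-- gradient of `LgE` -/
def dLgE (x : Euc n) : Euc n := (2 / (1 + ‖x‖ ^ 2)) • x

lemma Lg_hasDeriv (s : ℝ) : HasDerivAt Lg (dLg s) s := by
  have h : HasDerivAt (fun s : ℝ => 1 + s ^ 2) (2 * s) s := by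
    simpa using (hasDerivAt_pow 2 s).const_add 1
  exact h.log (by positivity)

lemma hasGradientAt_norm_sq (x x' : Euc n) (α : ℝ) :
    HasGradientAt (fun x => α * ‖x - x'‖ ^ 2) ((2 * α) • (x - x')) x := by
  rw [hasGradientAt_iff_hasFDerivAt]
  have h : HasFDerivAt (fun x : Euc n => ‖x - x'‖ ^ 2) _ x :=
    ((hasFDerivAt_id x).sub_const x').norm_sq
  refine (h.const_mul α).congr_fderiv ?_
  ext v
  simp [inner_smul_left]
  ring

lemma LgE_hasGrad (x : Euc n) : HasGradientAt LgE (dLgE x) x := by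
  rw [hasGradientAt_iff_hasFDerivAt]
  have h : HasFDerivAt (fun x : Euc n => 1 + ‖x‖ ^ 2) _ x :=
    ((hasFDerivAt_id x).norm_sq).const_add 1
  have := h.log (by positivity)
  refine this.congr_fderiv ?_
  ext v
  simp [dLgE, inner_smul_left]
  ring

lemma dLg_abs (s : ℝ) : |dLg s| ≤ 1 := by
  unfold dLg
  rw [abs_div, abs_of_pos (show (0 : ℝ) < 1 + s ^ 2 by positivity), div_le_one (by positivity), abs_mul]
  have := sq_nonneg (|s| - 1)
  have h2 : |s| ^ 2 = s ^ 2 := sq_abs s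
  simp only [Nat.abs_ofNat]
  nlinarith

lemma dLg_mul_abs (s : ℝ) : |dLg s * s| ≤ 2 := by
  unfold dLg
  have : 2 * s / (1 + s ^ 2) * s = 2 * s ^ 2 / (1 + s ^ 2) := by ring
  rw [this, abs_of_nonneg (by positivity), div_le_iff₀ (by positivity)]
  nlinarith

lemma dLgE_norm (x : Euc n) : ‖dLgE x‖ ≤ 1 := by
  have h := dLg_abs ‖x‖
  unfold dLg at h
  unfold dLgE
  rw [norm_smul, Real.norm_eq_abs, abs_of_nonneg (by positivity)]
  rw [abs_of_nonneg (by positivity)] at h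
  calc _ = 2 * ‖x‖ / (1 + ‖x‖ ^ 2) := by ring
    _ ≤ 1 := h

end PartB

section PartC

/-! ### Part C: the comparison principle -/

variable {n : ℕ}

def slab (n : ℕ) (T : ℝ) : Set (Dom n) := {z | 0 ≤ z.2.2 ∧ z.2.2 ≤ T}

/-- the penalisation of the doubling of variables -/
def pen (α c δ η σ : ℝ) (d : ℝ → ℝ) (z z' : Dom n) : ℝ :=
  α * ‖z.1 - z'.1‖ ^ 2 + c * Lg ((z.2.1 - z'.2.1) / δ) + c * Lg ((z.2.2 - z'.2.2) / η)
    + d z.2.2 + d z'.2.2 + σ * (LgE z.1 + Lg z.2.1) + σ * (LgE z'.1 + Lg z'.2.1)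

lemma Lg_cont : Continuous Lg := Lg_contDiff.continuous
lemma LgE_cont : Continuous (LgE (n := n)) := LgE_contDiff.continuous

lemma pen_cont (α c δ η σ : ℝ) {d : ℝ → ℝ} (hd : Continuous d) :
    Continuous (fun p : Dom n × Dom n => pen α c δ η σ d p.1 p.2) := by
  have := Lg_cont
  have := LgE_cont (n := n)
  unfold pen
  fun_prop

lemma exists_max {u v : Dom n → ℝ} {T₁ A α c δ η σ : ℝ} {d : ℝ → ℝ}
    (hu : UpperSemicontinuousOn u (slab n T₁)) (hv : LowerSemicontinuousOn v (slab n T₁))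
    (hA : ∀ z ∈ slab n T₁, ∀ z' ∈ slab n T₁, u z - v z' ≤ A) (hA0 : 0 ≤ A)
    (hd : Continuous d) (hd0 : ∀ t, 0 ≤ d t) (hα : 0 ≤ α) (hc : 0 ≤ c) (hσ : 0 < σ)
    {z₁ z₁' : Dom n} (hz : z₁ ∈ slab n T₁) (hz' : z₁' ∈ slab n T₁)
    (hpos : 0 < u z₁ - v z₁' - pen α c δ η σ d z₁ z₁') :
    ∃ w ∈ slab n T₁, ∃ w' ∈ slab n T₁, ∀ z ∈ slab n T₁, ∀ z' ∈ slab n T₁,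
      u z - v z' - pen α c δ η σ d z z' ≤ u w - v w' - pen α c δ η σ d w w' := by
  set R := Real.exp (A / σ) with hR
  let K : Set (Dom n) := Metric.closedBall 0 R ×ˢ Metric.closedBall 0 R ×ˢ Set.Icc 0 T₁
  have hK : IsCompact K :=
    (isCompact_closedBall _ _).prod ((isCompact_closedBall _ _).prod isCompact_Icc)
  have hKs : K ⊆ slab n T₁ := fun z hz => hz.2.2
  have hin : ∀ z ∈ slab n T₁, ∀ z' ∈ slab n T₁, 0 < u z - v z' - pen α c δ η σ d z z' →
      z ∈ K ∧ z' ∈ K := by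
    intro z hz z' hz' h
    have h1 := hA z hz z' hz'
    have e1 : 0 ≤ α * ‖z.1 - z'.1‖ ^ 2 := by positivity
    have e2 := mul_nonneg hc (Lg_nonneg ((z.2.1 - z'.2.1) / δ))
    have e3 := mul_nonneg hc (Lg_nonneg ((z.2.2 - z'.2.2) / η))
    have e4 := hd0 z.2.2
    have e5 := hd0 z'.2.2
    have e6 := mul_nonneg hσ.le (LgE_nonneg z.1)
    have e7 := mul_nonneg hσ.le (LgE_nonneg z'.1)
    have e8 := mul_nonneg hσ.le (Lg_nonneg z.2.1)
    have e9 := mul_nonneg hσ.le (Lg_nonneg z'.2.1)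
    unfold pen at h
    rw [mul_add, mul_add] at h
    have hAσ : 0 ≤ A / σ := by positivity
    refine ⟨⟨?_, ?_, hz⟩, ⟨?_, ?_, hz'⟩⟩
    · rw [mem_closedBall_zero_iff]
      exact LgE_bound hAσ (by rw [le_div_iff₀ hσ]; linarith)
    · rw [mem_closedBall_zero_iff]
      exact Lg_bound hAσ (by rw [le_div_iff₀ hσ]; linarith)
    · rw [mem_closedBall_zero_iff]
      exact LgE_bound hAσ (by rw [le_div_iff₀ hσ]; linarith)
    · rw [mem_closedBall_zero_iff]
      exact Lg_bound hAσ (by rw [le_div_iff₀ hσ]; linarith)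
  have husc : UpperSemicontinuousOn
      (fun p : Dom n × Dom n => u p.1 + (- v p.2) + (- pen α c δ η σ d p.1 p.2)) (K ×ˢ K) := by
    refine UpperSemicontinuousOn.add (UpperSemicontinuousOn.add ?_ ?_) ?_
    · exact UpperSemicontinuousOn.comp (hu.mono hKs) continuous_fst.continuousOn (fun p hp => hp.1)
    · have h : LowerSemicontinuousOn (fun p : Dom n × Dom n => v p.2) (K ×ˢ K) :=
        LowerSemicontinuousOn.comp (hv.mono hKs) continuous_snd.continuousOn (fun p hp => hp.2)
      exact continuous_neg.comp_lowerSemicontinuousOn_antitone h (fun a b h => neg_le_neg h)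
    · exact (pen_cont α c δ η σ hd).neg.continuousOn.upperSemicontinuousOn
  have hne := hin z₁ hz z₁' hz' hpos
  obtain ⟨⟨w, w'⟩, hw, hmax⟩ := husc.exists_isMaxOn ⟨(z₁, z₁'), hne⟩ (hK.prod hK)
  have hmax' : ∀ z ∈ K, ∀ z' ∈ K,
      u z - v z' - pen α c δ η σ d z z' ≤ u w - v w' - pen α c δ η σ d w w' := by
    intro z hz z' hz'
    have := hmax (show (z, z') ∈ K ×ˢ K from ⟨hz, hz'⟩)
    simp only [Set.mem_ofPred_eq] at this
    linarith
  refine ⟨w, hKs hw.1, w', hKs hw.2, fun z hz z' hz' => ?_⟩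
  by_cases h : 0 < u z - v z' - pen α c δ η σ d z z'
  · obtain ⟨a, b⟩ := hin z hz z' hz' h
    exact hmax' z a z' b
  · have := hmax' z₁ hne.1 z₁' hne.2
    linarith

lemma slab_nhds {T₁ : ℝ} {w : Dom n} (h0 : 0 < w.2.2) (h1 : w.2.2 < T₁) : slab n T₁ ∈ 𝓝 w := by
  have hc : Continuous (fun z : Dom n => z.2.2) := by fun_prop
  filter_upwards [hc.continuousAt.eventually (lt_mem_nhds h0),
    hc.continuousAt.eventually (gt_mem_nhds h1)] with z hz hz2
  exact ⟨hz.le, hz2.le⟩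

lemma sub_ineq {G : Ham n} {u : Dom n → ℝ} (hus : ViscSubPos G u) {T₁ α c δ η σ : ℝ} {d d' : ℝ → ℝ}
    (hd : ContDiff ℝ 1 d) (hd' : ∀ t, HasDerivAt d (d' t) t)
    {w w' : Dom n} (h0 : 0 < w.2.2) (h1 : w.2.2 < T₁)
    (hmax : ∀ z ∈ slab n T₁, u z - pen α c δ η σ d z w' ≤ u w - pen α c δ η σ d w w') :
    (c * (dLg ((w.2.2 - w'.2.2) / η) / η) + d' w.2.2) +
      G w.1 w.2.1 w.2.2 ((2 * α) • (w.1 - w'.1) + σ • dLgE w.1)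
        (c * (dLg ((w.2.1 - w'.2.1) / δ) / δ) + σ * dLg w.2.1) ≤ 0 := by
  have hLg := Lg_contDiff
  have hLgE := LgE_contDiff (n := n)
  have hcd := contDiff_sep (n := n)
    (a := fun x => α * ‖x - w'.1‖ ^ 2 + σ * LgE x)
    (b := fun y => c * Lg ((y - w'.2.1) / δ) + σ * Lg y)
    (d := fun t => c * Lg ((t - w'.2.2) / η) + d t)
    ((contDiff_const.mul ((contDiff_id.sub contDiff_const).norm_sq ℝ)).add (by fun_prop))
    (by fun_prop) (by fun_prop)
  have hg1 : HasGradientAt (fun x => α * ‖x - w'.1‖ ^ 2 + σ * LgE x)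
      ((2 * α) • (w.1 - w'.1) + σ • dLgE w.1) w.1 := by
    have e1 := hasGradientAt_norm_sq w.1 w'.1 α
    have e2 := LgE_hasGrad w.1
    rw [hasGradientAt_iff_hasFDerivAt] at *
    refine (e1.add (e2.const_mul σ)).congr_fderiv ?_
    simp
  have hscale : ∀ s s' τ : ℝ, HasDerivAt (fun y => c * Lg ((y - s') / τ)) (c * (dLg ((s - s') / τ) / τ)) s := by
    intro s s' τ
    have e : HasDerivAt (fun y : ℝ => (y - s') / τ) (1 / τ) s := ((hasDerivAt_id s).sub_const s').div_const τ
    have := ((Lg_hasDeriv ((s - s') / τ)).comp s e).const_mul c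
    exact this.congr_deriv (by ring)
  have hpd := pd_sep' (z := w) hg1
    ((hscale w.2.1 w'.2.1 δ).add ((Lg_hasDeriv w.2.1).const_mul σ))
    ((hscale w.2.2 w'.2.2 η).add (hd' w.2.2))
  have := hus _ hcd w h0 ?_
  · simp only [Pi.add_def] at hpd
    rw [hpd.1, hpd.2.1, hpd.2.2] at this
    exact this
  · filter_upwards [slab_nhds h0 h1] with z hz
    have := hmax z hz
    unfold pen at this
    linarith

lemma super_ineq {G : Ham n} {v : Dom n → ℝ} (hvs : ViscSuperPos G v) {T₁ α c δ η σ : ℝ} {d d' : ℝ → ℝ}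
    (hd : ContDiff ℝ 1 d) (hd' : ∀ t, HasDerivAt d (d' t) t)
    {w w' : Dom n} (h0 : 0 < w'.2.2) (h1 : w'.2.2 < T₁)
    (hmax : ∀ z ∈ slab n T₁, - v z - pen α c δ η σ d w z ≤ - v w' - pen α c δ η σ d w w') :
    0 ≤ (c * (dLg ((w.2.2 - w'.2.2) / η) / η) - d' w'.2.2) +
      G w'.1 w'.2.1 w'.2.2 ((2 * α) • (w.1 - w'.1) - σ • dLgE w'.1)
        (c * (dLg ((w.2.1 - w'.2.1) / δ) / δ) - σ * dLg w'.2.1) := by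
  have hLg := Lg_contDiff
  have hLgE := LgE_contDiff (n := n)
  have hcd := contDiff_sep (n := n)
    (a := fun x => (-α) * ‖x - w.1‖ ^ 2 + (-σ) * LgE x)
    (b := fun y => (-c) * Lg ((w.2.1 - y) / δ) + (-σ) * Lg y)
    (d := fun t => (-c) * Lg ((w.2.2 - t) / η) + (- d t))
    ((contDiff_const.mul ((contDiff_id.sub contDiff_const).norm_sq ℝ)).add (by fun_prop))
    (by fun_prop) (by fun_prop)
  have hg1 : HasGradientAt (fun x => (-α) * ‖x - w.1‖ ^ 2 + (-σ) * LgE x)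
      ((2 * α) • (w.1 - w'.1) - σ • dLgE w'.1) w'.1 := by
    have e1 := hasGradientAt_norm_sq w'.1 w.1 (-α)
    have e2 := LgE_hasGrad w'.1
    have e3 : (2 * α) • (w.1 - w'.1) - σ • dLgE w'.1
      = (2 * (-α)) • (w'.1 - w.1) + (-σ) • dLgE w'.1 := by module
    rw [e3]
    rw [hasGradientAt_iff_hasFDerivAt] at *
    refine (e1.add (e2.const_mul (-σ))).congr_fderiv ?_
    simp
  have hscale : ∀ s s' τ : ℝ, HasDerivAt (fun y => (-c) * Lg ((s - y) / τ)) (c * (dLg ((s - s') / τ) / τ)) s' := by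
    intro s s' τ
    have e : HasDerivAt (fun y : ℝ => (s - y) / τ) (-1 / τ) s' := ((hasDerivAt_id s').const_sub s).div_const τ
    have := ((Lg_hasDeriv ((s - s') / τ)).comp s' e).const_mul (-c)
    exact this.congr_deriv (by ring)
  have hpd := pd_sep' (z := w') hg1
    ((hscale w.2.1 w'.2.1 δ).add ((Lg_hasDeriv w'.2.1).const_mul (-σ)))
    ((hscale w.2.2 w'.2.2 η).add (hd' w'.2.2).neg)
  have := hvs _ hcd w' h0 ?_
  · simp only [Pi.add_def, Pi.neg_def] at hpd
    rw [hpd.1, hpd.2.1, hpd.2.2] at this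
    rw [neg_mul, ← sub_eq_add_neg, ← sub_eq_add_neg] at this
    exact this
  · filter_upwards [slab_nhds h0 h1] with z hz
    have := hmax z hz
    unfold pen at this
    rw [norm_sub_rev w'.1, norm_sub_rev z.1]
    linarith

lemma numeric {G : Ham n} {C₁ C₂ l C₃ C₄ C₅ : ℝ} (h1 : HypH1 G) (h2 : HypH2 G C₁ C₂)
    (h3 : HypH3 G l C₃ C₄ C₅) {x x' P P' : Euc n} {y y' t t' py Q Q' pt d₁ d₂ c θ R ω Dt M : ℝ}
    (hθ : 0 < θ) (hsub : pt + d₁ + G x y t P Q ≤ 0) (hsup : 0 ≤ pt - d₂ + G x' y' t' P' Q')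
    (hd₁ : θ ≤ d₁) (hd₂ : θ ≤ d₂)
    (hω : ∀ (x x' : Euc n) (y t : ℝ) (px px' : Euc n) (py py' : ℝ),
      ‖px‖ ≤ R → |py| ≤ R → ‖px'‖ ≤ R → |py'| ≤ R →
      ‖x - x'‖ ≤ ω → ‖px - px'‖ ≤ ω → |py - py'| ≤ ω → |G x y t px py - G x' y t px' py'| ≤ θ / 4)
    (hx : ‖x - x'‖ ≤ ω) (hPP : ‖P - P'‖ ≤ ω) (hQQ : |Q - Q'| ≤ ω) (hPP2 : ‖P - P'‖ ≤ 2)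
    (hQQ2 : |Q - Q'| ≤ 2) (hQ1 : |Q - py| ≤ 1) (hQM : |Q| ≤ M)
    (hR1 : (C₂ + C₅ * M + Dt) / C₁ + 2 ≤ R) (hR2 : M + 2 ≤ R) (hDt : |pt| ≤ Dt)
    (hy1 : |py * (y' - y)| ≤ 2 * c) (ht1 : |pt * (t' - t)| ≤ 2 * c)
    (hc : 2 * c * (C₃ + 2 * C₄) ≤ θ / 4)
    (hDy : C₃ * (|l| + 1) * |y' - y| ≤ θ / 4) (ht2 : C₄ * |t' - t| ≤ 1 / 2)
    (ht3 : 2 * C₄ * |t' - t| * (1 + (1 + C₅) * M + C₂ + θ) ≤ θ / 4) : False := by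
  obtain ⟨hC3, hC4, hC5, -⟩ := id h3
  obtain ⟨hC1, hC2, -⟩ := id h2
  have hco := G_coer h1 h2 h3 x y t P Q
  have hc0 : 0 ≤ c := by linarith [abs_nonneg (py * (y' - y))]
  have hC5M : C₅ * |Q| ≤ C₅ * M := by gcongr
  have hC1P : 0 ≤ C₁ * ‖P‖ := by positivity
  have hptl := (abs_le.1 hDt).1
  have hP : ‖P‖ ≤ R - 2 := by
    have : ‖P‖ ≤ (C₂ + C₅ * M + Dt) / C₁ := by
      rw [le_div_iff₀ hC1]; linarith
    linarith
  have hP' : ‖P'‖ ≤ R := by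
    have : P' = P - (P - P') := by abel
    rw [this]; refine (norm_sub_le _ _).trans ?_; linarith
  have hQ' : |Q'| ≤ R := by
    have : Q' = Q - (Q - Q') := by ring
    rw [this]; refine (abs_sub _ _).trans ?_; linarith
  have s1 := hω x x' y' t' P P' Q Q' (by linarith) (by linarith) hP' hQ' hx hPP hQQ
  have s2 := G_lip_y h1 h3 x y y' t P Q
  have s3 := G_lip_t h1 h3 x y' t t' P Q ht2
  set γ := G x y t P Q
  set g1 := G x y' t P Q
  set g2 := G x y' t' P Q
  set g3 := G x' y' t' P' Q'
  have b2 : |g1 - γ| ≤ 2 * c * C₃ + θ / 4 := by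
    refine s2.trans ?_
    have : |Q + l| * |y' - y| ≤ 2 * c + (|l| + 1) * |y' - y| := by
      have e : |Q + l| ≤ |py| + (|l| + 1) := by
        have : Q + l = py + (l + (Q - py)) := by ring
        rw [this]
        refine (abs_add_le _ _).trans ?_
        have := abs_add_le l (Q - py)
        linarith
      calc |Q + l| * |y' - y| ≤ (|py| + (|l| + 1)) * |y' - y| := by gcongr
        _ = |py * (y' - y)| + (|l| + 1) * |y' - y| := by rw [abs_mul]; ring
        _ ≤ _ := by linarith
    calc C₃ * |Q + l| * |y' - y| = C₃ * (|Q + l| * |y' - y|) := by ring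
      _ ≤ C₃ * (2 * c + (|l| + 1) * |y' - y|) := by gcongr
      _ = 2 * c * C₃ + C₃ * (|l| + 1) * |y' - y| := by ring
      _ ≤ _ := by linarith
  have hcC : 0 ≤ c * C₄ := by positivity
  have hcC3 : 0 ≤ c * C₃ := by positivity
  have b2' : |g1 - γ| ≤ θ / 2 := by nlinarith
  have hγ : |γ| ≤ C₂ + C₅ * M + |pt| := by
    rw [abs_le]
    constructor
    · linarith [abs_nonneg pt]
    · have := neg_abs_le pt
      have : 0 ≤ C₅ * |Q| := by positivity
      linarith
  have hg1 : |g1| ≤ C₂ + C₅ * M + |pt| + θ := by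
    have : g1 = γ + (g1 - γ) := by ring
    have := abs_add_le γ (g1 - γ)
    rw [← ‹g1 = γ + (g1 - γ)›] at this
    linarith
  have b3 : |g2 - g1| ≤ θ / 4 + 4 * (c * C₄) := by
    refine s3.trans ?_
    calc 2 * C₄ * (1 + |Q| + |g1|) * |t' - t|
        ≤ 2 * C₄ * (1 + M + (C₂ + C₅ * M + |pt| + θ)) * |t' - t| := by gcongr
      _ = 2 * C₄ * |t' - t| * (1 + (1 + C₅) * M + C₂ + θ) + 2 * C₄ * |pt * (t' - t)| := by
          rw [abs_mul]; ring
      _ ≤ θ / 4 + 2 * C₄ * (2 * c) := by gcongr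
      _ = _ := by ring
  have a1 := (abs_le.1 s1).1
  have a2 := (abs_le.1 b2').2
  have a3 := (abs_le.1 b3).2
  nlinarith

end PartC

section PartD

/-! ### Part D: strong comparison -/

variable {n : ℕ}

set_option maxHeartbeats 1000000 in
lemma core_claim {G : Ham n} {C₁ C₂ l C₃ C₄ C₅ : ℝ} (h1 : HypH1 G) (h2 : HypH2 G C₁ C₂)
    (h3 : HypH3 G l C₃ C₄ C₅) {u v : Dom n → ℝ} (hus : ViscSubPos G u) (hvs : ViscSuperPos G v)
    {T₁ A α c δ η σ θ E M R Dt ω m ρ₀ ε : ℝ} {d d' : ℝ → ℝ}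
    (hu : UpperSemicontinuousOn u (slab n T₁)) (hv : LowerSemicontinuousOn v (slab n T₁))
    (hA : ∀ z ∈ slab n T₁, ∀ z' ∈ slab n T₁, u z - v z' ≤ A) (hA0 : 0 < A)
    (hd : ContDiff ℝ 1 d) (hd' : ∀ t, HasDerivAt d (d' t) t) (hd0 : ∀ t, 0 ≤ d t)
    (hdT : A < d T₁) (hdθ : ∀ t, 0 ≤ t → θ ≤ d' t) (hθ : 0 < θ)
    (hc : 0 < c) (hδ : 0 < δ) (hη : 0 < η) (hσ : 0 < σ) (hσ1 : σ ≤ 1) (hσω : σ ≤ ω / 2)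
    (hm : 0 < m) (hmω : m ≤ ω) (hmρ : m ≤ ρ₀) (hα : α = A / m ^ 2) (hE : E = Real.exp (A / c))
    (hε : 0 < ε)
    (hinit : ∀ z z' : Dom n, 0 ≤ z.2.2 → 0 ≤ z'.2.2 → z.2.2 ≤ ρ₀ → z'.2.2 ≤ ρ₀ →
      ‖z.1 - z'.1‖ ≤ ρ₀ → |z.2.1 - z'.2.1| ≤ ρ₀ → u z - v z' ≤ ε / 4)
    (hcθ : 2 * c * (C₃ + 2 * C₄) ≤ θ / 4)
    (hδρ : δ * E ≤ ρ₀) (hδ3 : C₃ * (|l| + 1) * (δ * E) ≤ θ / 4)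
    (hM : M = c / δ + 1) (hηρ : η * E ≤ ρ₀) (hη4 : C₄ * (η * E) ≤ 1 / 2)
    (hη5 : 2 * C₄ * (η * E) * (1 + (1 + C₅) * M + C₂ + θ) ≤ θ / 4)
    (hDt : Dt = c / η)
    (hR1 : (C₂ + C₅ * M + Dt) / C₁ + 2 ≤ R) (hR2 : M + 2 ≤ R)
    (hω : ∀ (x x' : Euc n) (y t : ℝ) (px px' : Euc n) (py py' : ℝ),
      ‖px‖ ≤ R → |py| ≤ R → ‖px'‖ ≤ R → |py'| ≤ R →
      ‖x - x'‖ ≤ ω → ‖px - px'‖ ≤ ω → |py - py'| ≤ ω → |G x y t px py - G x' y t px' py'| ≤ θ / 4) :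
    ∀ z ∈ slab n T₁, ∀ z' ∈ slab n T₁, u z - v z' - pen α c δ η σ d z z' ≤ ε / 2 := by
  by_contra hcon
  push Not at hcon
  obtain ⟨z₁, hz₁, z₁', hz₁', hpos⟩ := hcon
  obtain ⟨hC3, hC4, hC5, -⟩ := id h3
  obtain ⟨hC1, hC2, -⟩ := id h2
  have hα0 : 0 < α := by rw [hα]; positivity
  obtain ⟨w, hw, w', hw', hmax⟩ := exists_max hu hv hA hA0.le hd.continuous hd0 hα0.le hc.le hσ
    hz₁ hz₁' (by linarith)
  have hval := hmax z₁ hz₁ z₁' hz₁'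
  have hAw := hA w hw w' hw'
  have e1 : 0 ≤ α * ‖w.1 - w'.1‖ ^ 2 := by positivity
  have e2 := mul_nonneg hc.le (Lg_nonneg ((w.2.1 - w'.2.1) / δ))
  have e3 := mul_nonneg hc.le (Lg_nonneg ((w.2.2 - w'.2.2) / η))
  have e4 := hd0 w.2.2
  have e5 := hd0 w'.2.2
  have e6 := mul_nonneg hσ.le (add_nonneg (LgE_nonneg w.1) (Lg_nonneg w.2.1))
  have e7 := mul_nonneg hσ.le (add_nonneg (LgE_nonneg w'.1) (Lg_nonneg w'.2.1))
  have hpenv : pen α c δ η σ d w w' = α * ‖w.1 - w'.1‖ ^ 2 + c * Lg ((w.2.1 - w'.2.1) / δ) + c * Lg ((w.2.2 - w'.2.2) / η)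
    + d w.2.2 + d w'.2.2 + σ * (LgE w.1 + Lg w.2.1) + σ * (LgE w'.1 + Lg w'.2.1) := rfl
  have hAc : 0 ≤ A / c := by positivity
  -- smallness of the differences
  have hx : ‖w.1 - w'.1‖ ≤ m := by
    have : α * ‖w.1 - w'.1‖ ^ 2 ≤ A := by linarith
    rw [hα, div_mul_eq_mul_div, div_le_iff₀ (by positivity)] at this
    have := le_of_mul_le_mul_left this hA0
    exact (sq_le_sq₀ (norm_nonneg _) hm.le).1 this
  have hscal : ∀ (s τ : ℝ), 0 < τ → c * Lg (s / τ) ≤ A → |s| ≤ τ * E := by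
    intro s τ hτ h
    have h1 : Lg (s / τ) ≤ A / c := by rw [le_div_iff₀ hc]; linarith
    have h2 := Lg_bound hAc h1
    rw [abs_div, abs_of_pos hτ, div_le_iff₀ hτ] at h2
    rw [hE]; linarith
  have hy : |w.2.1 - w'.2.1| ≤ δ * E := hscal _ _ hδ (by linarith)
  have ht : |w.2.2 - w'.2.2| ≤ η * E := hscal _ _ hη (by linarith)
  have hwT : w.2.2 < T₁ := by
    refine lt_of_le_of_ne hw.2 (fun h => ?_)
    rw [← h] at hdT; linarith
  have hwT' : w'.2.2 < T₁ := by
    refine lt_of_le_of_ne hw'.2 (fun h => ?_)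
    rw [← h] at hdT; linarith
  have ht0 := abs_le.1 ht
  have hw0 : 0 < w.2.2 := by
    refine lt_of_le_of_ne hw.1 (fun h => ?_)
    have := hinit w w' hw.1 hw'.1 (by linarith [hw'.1]) (by linarith) (by linarith) (by linarith)
    linarith
  have hw0' : 0 < w'.2.2 := by
    refine lt_of_le_of_ne hw'.1 (fun h => ?_)
    have := hinit w w' hw.1 hw'.1 (by linarith [hw'.1]) (by linarith [hw.1]) (by linarith) (by linarith)
    linarith
  have hsub := sub_ineq hus hd hd' (w' := w') (α := α) (c := c) (δ := δ) (η := η) (σ := σ) hw0 hwT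
    (fun z hz => by linarith [hmax z hz w' hw'])
  have hsup := super_ineq hvs hd hd' (w := w) (α := α) (c := c) (δ := δ) (η := η) (σ := σ) hw0' hwT'
    (fun z hz => by linarith [hmax w hw z hz])
  have hb1 : ∀ (s τ : ℝ), 0 < τ → |c * (dLg (s / τ) / τ)| ≤ c / τ := by
    intro s τ hτ
    rw [abs_mul, abs_div, abs_of_pos hc, abs_of_pos hτ, ← mul_div_assoc]
    have := mul_le_of_le_one_right hc.le (dLg_abs (s / τ))
    gcongr
  have hb2 : ∀ (s s' τ : ℝ), 0 < τ → |c * (dLg ((s - s') / τ) / τ) * (s' - s)| ≤ 2 * c := by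
    intro s s' τ hτ
    have : c * (dLg ((s - s') / τ) / τ) * (s' - s) = - (c * (dLg ((s - s') / τ) * ((s - s') / τ))) := by
      field_simp; ring
    rw [this, abs_neg, abs_mul, abs_of_pos hc]
    have := mul_le_mul_of_nonneg_left (dLg_mul_abs ((s - s') / τ)) hc.le
    linarith only [this]
  have q1 : ∀ s : ℝ, |σ * dLg s| ≤ σ := by
    intro s
    rw [abs_mul, abs_of_pos hσ]; exact mul_le_of_le_one_right hσ.le (dLg_abs s)
  have q2 : ∀ x : Euc n, ‖σ • dLgE x‖ ≤ σ := by
    intro x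
    rw [norm_smul, Real.norm_of_nonneg hσ.le]; exact mul_le_of_le_one_right hσ.le (dLgE_norm x)
  have hPP : ‖((2 * α) • (w.1 - w'.1) + σ • dLgE w.1) - ((2 * α) • (w.1 - w'.1) - σ • dLgE w'.1)‖ ≤ 2 * σ := by
    rw [show ((2 * α) • (w.1 - w'.1) + σ • dLgE w.1) - ((2 * α) • (w.1 - w'.1) - σ • dLgE w'.1)
      = σ • dLgE w.1 + σ • dLgE w'.1 by abel]
    refine (norm_add_le _ _).trans ?_
    linarith [q2 w.1, q2 w'.1]
  have hQQ : |(c * (dLg ((w.2.1 - w'.2.1) / δ) / δ) + σ * dLg w.2.1) -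
      (c * (dLg ((w.2.1 - w'.2.1) / δ) / δ) - σ * dLg w'.2.1)| ≤ 2 * σ := by
    rw [show (c * (dLg ((w.2.1 - w'.2.1) / δ) / δ) + σ * dLg w.2.1) -
      (c * (dLg ((w.2.1 - w'.2.1) / δ) / δ) - σ * dLg w'.2.1) = σ * dLg w.2.1 + σ * dLg w'.2.1 by ring]
    refine (abs_add_le _ _).trans ?_
    linarith [q1 w.2.1, q1 w'.2.1]
  refine numeric h1 h2 h3 (c := c) (M := M) (R := R) (ω := ω) (Dt := Dt)
    (py := c * (dLg ((w.2.1 - w'.2.1) / δ) / δ)) hθ hsub hsup (hdθ _ hw.1) (hdθ _ hw'.1) hω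
    (hx.trans hmω) (by linarith) (by linarith) (by linarith) (by linarith) ?_ ?_ hR1 hR2 ?_ ?_ ?_ hcθ ?_ ?_ ?_
  · rw [add_sub_cancel_left]; linarith [q1 w.2.1]
  · refine (abs_add_le _ _).trans ?_
    linarith [hb1 (w.2.1 - w'.2.1) δ hδ, q1 w.2.1]
  · rw [hDt]; exact hb1 _ _ hη
  · exact hb2 _ _ _ hδ
  · exact hb2 _ _ _ hη
  · rw [abs_sub_comm]
    refine le_trans ?_ hδ3
    gcongr
  · rw [abs_sub_comm]
    refine le_trans ?_ hη4
    gcongr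
  · rw [abs_sub_comm]
    refine le_trans ?_ hη5
    have : 0 < M := by rw [hM]; positivity
    gcongr

lemma exists_small (K s : ℝ) (hs : 0 < s) (hK : 0 ≤ K) : ∃ δ > 0, ∀ δ', 0 ≤ δ' → δ' ≤ δ → K * δ' ≤ s := by
  refine ⟨s / (K + 1), by positivity, fun δ' h0 h => ?_⟩
  rw [le_div_iff₀ (by positivity)] at h
  linarith

set_option maxHeartbeats 1000000 in
theorem strong_comparison {G : Ham n} {C₁ C₂ l C₃ C₄ C₅ : ℝ} (h1 : HypH1 G) (h2 : HypH2 G C₁ C₂)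
    (h3 : HypH3 G l C₃ C₄ C₅) {u v : Dom n → ℝ} (hus : ViscSubPos G u) (hvs : ViscSuperPos G v)
    (hu : UpperSemicontinuousOn u {z | 0 ≤ z.2.2}) (hv : LowerSemicontinuousOn v {z | 0 ≤ z.2.2})
    (hub : ∀ T : ℝ, 0 < T → ∃ A, ∀ z ∈ slab n T, u z ≤ A)
    (hvb : ∀ T : ℝ, 0 < T → ∃ A, ∀ z ∈ slab n T, -A ≤ v z)
    {v₀ : Dom2 n → ℝ} (hv₀ : UniformContinuous v₀)
    (hu0 : ∀ ε > 0, ∃ ρ > 0, ∀ z : Dom n, 0 ≤ z.2.2 → z.2.2 ≤ ρ → u z ≤ v₀ (z.1, z.2.1) + ε)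
    (hv0 : ∀ ε > 0, ∃ ρ > 0, ∀ z : Dom n, 0 ≤ z.2.2 → z.2.2 ≤ ρ → v₀ (z.1, z.2.1) - ε ≤ v z)
    (T : ℝ) (hT : 0 < T) (ε : ℝ) (hε : 0 < ε) :
    ∃ ρ > 0, ∀ z ∈ slab n T, ∀ z' ∈ slab n T, dist z z' ≤ ρ → u z ≤ v z' + ε := by
  obtain ⟨hC3, hC4, hC5, -⟩ := id h3
  obtain ⟨hC1, hC2, -⟩ := id h2
  obtain ⟨A1, hA1⟩ := hub (T + 1) (by linarith)
  obtain ⟨A2, hA2⟩ := hvb (T + 1) (by linarith)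
  set A := max 1 (A1 + A2) with hAdef
  have hA0 : 0 < A := by positivity
  have hA : ∀ z ∈ slab n (T + 1), ∀ z' ∈ slab n (T + 1), u z - v z' ≤ A := fun z hz z' hz' => by
    linarith [hA1 z hz, hA2 z' hz', le_max_right 1 (A1 + A2)]
  set κ := ε / 16 with hκ
  have hκ0 : 0 < κ := by positivity
  set L := A / κ with hL
  have hL0 : 0 < L := by positivity
  set d : ℝ → ℝ := fun t => κ * Real.exp (L * (t - T)) with hd
  set d' : ℝ → ℝ := fun t => κ * (Real.exp (L * (t - T)) * L) with hd'
  set θ := κ * (Real.exp (L * (0 - T)) * L) with hθ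
  have hθ0 : 0 < θ := by positivity
  have hdc : ContDiff ℝ 1 d := by fun_prop
  have hdd : ∀ t, HasDerivAt d (d' t) t := by
    intro t
    have : HasDerivAt (fun t => L * (t - T)) L t := by
      simpa using ((hasDerivAt_id t).sub_const T).const_mul L
    exact (this.exp).const_mul κ
  obtain ⟨ρ1, hρ1, hi1⟩ := hu0 (ε / 12) (by positivity)
  obtain ⟨ρ2, hρ2, hi2⟩ := hv0 (ε / 12) (by positivity)
  obtain ⟨ρ3, hρ3, hi3⟩ := Metric.uniformContinuous_iff.1 hv₀ (ε / 12) (by positivity)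
  set ρ₀ := min (min ρ1 ρ2) (ρ3 / 2) with hρ₀
  have hρ₀0 : 0 < ρ₀ := by positivity
  have r1 : ρ₀ ≤ ρ1 := (min_le_left _ _).trans (min_le_left _ _)
  have r2 : ρ₀ ≤ ρ2 := (min_le_left _ _).trans (min_le_right _ _)
  have r3 : ρ₀ < ρ3 := (min_le_right _ _).trans_lt (by linarith)
  have hinit : ∀ z z' : Dom n, 0 ≤ z.2.2 → 0 ≤ z'.2.2 → z.2.2 ≤ ρ₀ → z'.2.2 ≤ ρ₀ →
      ‖z.1 - z'.1‖ ≤ ρ₀ → |z.2.1 - z'.2.1| ≤ ρ₀ → u z - v z' ≤ ε / 4 := by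
    intro z z' a b a' b' hx hy
    have q1 := hi1 z a (a'.trans r1)
    have q2 := hi2 z' b (b'.trans r2)
    have q3 := @hi3 (z.1, z.2.1) (z'.1, z'.2.1) (by
      rw [Prod.dist_eq, dist_eq_norm, Real.dist_eq]
      exact max_lt (hx.trans_lt r3) (hy.trans_lt r3))
    rw [Real.dist_eq] at q3
    linarith [(abs_lt.1 q3).2]
  set c := θ / (8 * (C₃ + 2 * C₄ + 1)) with hc
  have hc0 : 0 < c := by positivity
  have hcθ : 2 * c * (C₃ + 2 * C₄) ≤ θ / 4 := by
    have : c * (8 * (C₃ + 2 * C₄ + 1)) = θ := by rw [hc]; field_simp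
    linarith
  set E := Real.exp (A / c) with hE
  have hE0 : 0 < E := Real.exp_pos _
  obtain ⟨δ1, hδ1, hδ1'⟩ := exists_small E ρ₀ hρ₀0 hE0.le
  obtain ⟨δ2, hδ2, hδ2'⟩ := exists_small (C₃ * (|l| + 1) * E) (θ / 4) (by positivity) (by positivity)
  set δ := min δ1 δ2 with hδ
  have hδ0 : 0 < δ := by positivity
  set M := c / δ + 1 with hM
  have hM0 : 0 < M := by positivity
  obtain ⟨η1, hη1, hη1'⟩ := exists_small E ρ₀ hρ₀0 hE0.le
  obtain ⟨η2, hη2, hη2'⟩ := exists_small (C₄ * E) (1 / 2) (by positivity) (by positivity)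
  obtain ⟨η3, hη3, hη3'⟩ := exists_small (2 * C₄ * E * (1 + (1 + C₅) * M + C₂ + θ)) (θ / 4)
    (by positivity) (by positivity)
  set η := min (min η1 η2) η3 with hη
  have hη0 : 0 < η := by positivity
  set Dt := c / η with hDt
  set R := max ((C₂ + C₅ * M + Dt) / C₁ + 2) (M + 2) with hR
  obtain ⟨ω, hω0, hω⟩ := G_uc h1 R (θ / 4) (by positivity)
  set m := min ω ρ₀ with hm
  have hm0 : 0 < m := lt_min hω0 hρ₀0
  set α := A / m ^ 2 with hα
  have hdle : ∀ t, t ≤ T → d t ≤ κ := by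
    intro t ht
    have : Real.exp (L * (t - T)) ≤ 1 := by
      rw [Real.exp_le_one_iff]; exact mul_nonpos_of_nonneg_of_nonpos hL0.le (by linarith only [ht])
    exact mul_le_of_le_one_right hκ0.le this
  have hsubs : slab n (T + 1) ⊆ {z | 0 ≤ z.2.2} := fun z hz => hz.1
  have key : ∀ σ, 0 < σ → σ ≤ min 1 (ω / 2) →
      ∀ z ∈ slab n (T + 1), ∀ z' ∈ slab n (T + 1), u z - v z' - pen α c δ η σ d z z' ≤ ε / 2 := by
    intro σ hσ hσ1
    refine core_claim h1 h2 h3 hus hvs (hu.mono hsubs) (hv.mono hsubs) hA hA0 hdc hdd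
      (fun t => by positivity) ?_ (fun t ht => ?_) hθ0 hc0 hδ0 hη0 hσ (hσ1.trans (min_le_left _ _))
      (hσ1.trans (min_le_right _ _)) hm0 (min_le_left _ _) (min_le_right _ _) hα hE hε hinit hcθ
      ?_ ?_ hM ?_ ?_ ?_ hDt (le_max_left _ _) (le_max_right _ _) hω
    · have e := Real.add_one_le_exp L
      have e2 : κ * L = A := by rw [hL]; field_simp
      simp only [hd, add_sub_cancel_left, mul_one]
      have := mul_le_mul_of_nonneg_left e hκ0.le
      linarith only [this, e2, hκ0]
    · simp only [hθ, hd']; gcongr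
    · linarith [hδ1' δ hδ0.le (min_le_left _ _)]
    · linarith [hδ2' δ hδ0.le (min_le_right _ _)]
    · linarith [hη1' η hη0.le ((min_le_left _ _).trans (min_le_left _ _))]
    · linarith [hη2' η hη0.le ((min_le_left _ _).trans (min_le_right _ _))]
    · linarith [hη3' η hη0.le (min_le_right _ _)]
  -- let σ → 0
  have key2 : ∀ z ∈ slab n (T + 1), ∀ z' ∈ slab n (T + 1), u z - v z' - pen α c δ η 0 d z z' ≤ ε / 2 := by
    intro z hz z' hz'
    have hcont : Tendsto (fun σ => u z - v z' - pen α c δ η σ d z z') (𝓝[>] 0)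
        (𝓝 (u z - v z' - pen α c δ η 0 d z z')) := by
      apply Tendsto.mono_left _ nhdsWithin_le_nhds
      apply Continuous.tendsto
      unfold pen
      fun_prop
    refine le_of_tendsto hcont ?_
    have hpos : (0 : ℝ) < min 1 (ω / 2) := by positivity
    filter_upwards [Ioc_mem_nhdsGT hpos] with σ hσ
    exact key σ hσ.1 hσ.2 z hz z' hz'
  have hfc : Continuous (fun s : ℝ => α * s ^ 2 + c * Lg (s / δ) + c * Lg (s / η)) := by
    have := Lg_cont
    fun_prop
  have hmono : ∀ {s s' τ : ℝ}, |s| ≤ s' → 0 < τ → Lg (s / τ) ≤ Lg (s' / τ) := by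
    intro s s' τ h hτ
    unfold Lg
    apply Real.log_le_log (by positivity)
    have : (s / τ) ^ 2 ≤ (s' / τ) ^ 2 := by
      rw [div_pow, div_pow]
      have := sq_le_sq' (by linarith [neg_abs_le s]) ((le_abs_self s).trans h)
      exact div_le_div_of_nonneg_right this (by positivity)
    linarith
  have h0 := (hfc.tendsto 0).eventually (eventually_lt_nhds (b := ε / 8) (by
    simp only [Lg, zero_div]; norm_num; exact hε))
  obtain ⟨ρ, hρ, hρ'⟩ := Metric.eventually_nhds_iff.1 h0
  refine ⟨ρ / 2, by positivity, fun z hz z' hz' hzz => ?_⟩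
  have k := key2 z ⟨hz.1, hz.2.trans (by linarith)⟩ z' ⟨hz'.1, hz'.2.trans (by linarith)⟩
  have k2 := @hρ' (ρ / 2) (by rw [Real.dist_eq, sub_zero, abs_of_pos (by positivity)]; linarith)
  simp only [Prod.dist_eq, max_le_iff, Real.dist_eq, dist_eq_norm z.1] at hzz
  have m1 := hmono hzz.2.1 hδ0
  have m2 := hmono hzz.2.2 hη0
  have m3 : α * ‖z.1 - z'.1‖ ^ 2 ≤ α * (ρ / 2) ^ 2 := by
    have : 0 ≤ α := by positivity
    gcongr
    exact hzz.1
  have d1 := hdle _ hz.2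
  have d2 := hdle _ hz'.2
  have m1' := mul_le_mul_of_nonneg_left m1 hc0.le
  have m2' := mul_le_mul_of_nonneg_left m2 hc0.le
  unfold pen at k
  linarith

end PartD

section PartE

/-! ### Part E: envelopes, barriers -/

variable {n : ℕ}

/-- upper semicontinuous envelope -/
def uenv (f : Dom n → ℝ) (z : Dom n) : ℝ := sInf {a | ∀ᶠ w in 𝓝 z, f w ≤ a}

lemma uenv_bddBelow (f : Dom n → ℝ) (z : Dom n) : BddBelow {a | ∀ᶠ w in 𝓝 z, f w ≤ a} :=
  ⟨f z, fun _ ha => ha.self_of_nhds⟩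

lemma uenv_le_of {f : Dom n → ℝ} {z : Dom n} {a : ℝ} (h : ∀ᶠ w in 𝓝 z, f w ≤ a) : uenv f z ≤ a :=
  csInf_le (uenv_bddBelow f z) h

lemma uenv_le_cont {f g : Dom n → ℝ} (hg : Continuous g) (h : ∀ z, f z ≤ g z) (z : Dom n) :
    uenv f z ≤ g z := by
  refine le_of_forall_pos_le_add fun ε hε => uenv_le_of ?_
  filter_upwards [(hg.tendsto z).eventually (eventually_lt_nhds (b := g z + ε) (by linarith))] with w hw
  linarith [h w]

lemma uenv_nonempty {f g : Dom n → ℝ} (hg : Continuous g) (h : ∀ z, f z ≤ g z) (z : Dom n) :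
    {a | ∀ᶠ w in 𝓝 z, f w ≤ a}.Nonempty := by
  refine ⟨g z + 1, ?_⟩
  filter_upwards [(hg.tendsto z).eventually (eventually_lt_nhds (b := g z + 1) (by linarith))] with w hw
  linarith [h w]

lemma le_uenv {f g : Dom n → ℝ} (hg : Continuous g) (h : ∀ z, f z ≤ g z) (z : Dom n) :
    f z ≤ uenv f z :=
  le_csInf (uenv_nonempty hg h z) (fun _ ha => ha.self_of_nhds)

lemma uenv_usc {f g : Dom n → ℝ} (hg : Continuous g) (h : ∀ z, f z ≤ g z) :
    UpperSemicontinuous (uenv f) := by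
  intro z b hb
  obtain ⟨a, ha, hab⟩ := exists_lt_of_csInf_lt (uenv_nonempty hg h z) hb
  have ha' : ∀ᶠ w in 𝓝 z, f w ≤ a := ha
  filter_upwards [eventually_eventually_nhds.2 ha'] with w hw
  exact (uenv_le_of hw).trans_lt hab

lemma uenv_approx (f : Dom n → ℝ) (z : Dom n) {b : ℝ} (hb : b < uenv f z) :
    ∃ᶠ w in 𝓝 z, b < f w := by
  intro h
  have : ∀ᶠ w in 𝓝 z, f w ≤ b := by
    filter_upwards [h] with w hw
    exact not_lt.1 hw
  linarith [uenv_le_of this]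

/-- the form of the derivative of a function with prescribed partial derivatives -/
def clm (px : Euc n) (py pt : ℝ) : Dom n →L[ℝ] ℝ :=
  (((innerSL ℝ px).comp (ContinuousLinearMap.fst ℝ (Euc n) (ℝ × ℝ)))
      + (py • ((ContinuousLinearMap.fst ℝ ℝ ℝ).comp (ContinuousLinearMap.snd ℝ (Euc n) (ℝ × ℝ))))
      + (pt • ((ContinuousLinearMap.snd ℝ ℝ ℝ).comp (ContinuousLinearMap.snd ℝ (Euc n) (ℝ × ℝ)))))

/-- the operator φ ↦ φ_t + G(x,y,t,Dφ) -/
def FF (G : Ham n) (φ : Dom n → ℝ) (z : Dom n) : ℝ :=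
  pdT φ z + G z.1 z.2.1 z.2.2 (pdX φ z) (pdY φ z)

lemma FF_congr (G : Ham n) {φ ψ : Dom n → ℝ} {z : Dom n} (h : fderiv ℝ φ z = fderiv ℝ ψ z) :
    FF G φ z = FF G ψ z := by
  simp only [FF, pdT, pdX, pdY, h]

lemma FF_cont {G : Ham n} (h1 : HypH1 G) {φ : Dom n → ℝ} (hφ : ContDiff ℝ 1 φ) :
    Continuous (FF G φ) := by
  have hf : Continuous (fderiv ℝ φ) := hφ.continuous_fderiv (by norm_num)
  have hv : ∀ v : Dom n, Continuous (fun z => fderiv ℝ φ z v) := fun v => hf.clm_apply continuous_const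
  have hX : Continuous (pdX φ) := by
    unfold pdX
    exact (PiLp.continuous_toLp 2 _).comp (continuous_pi fun i => hv _)
  have hY : Continuous (pdY φ) := hv _
  have hT : Continuous (pdT φ) := hv _
  unfold FF
  refine hT.add ?_
  exact h1.1.comp (f := fun z : Dom n => (z.1, z.2.1, z.2.2, pdX φ z, pdY φ z)) (by fun_prop)

/-- quadratic localisation -/
def QQ (z₀ z : Dom n) : ℝ := ‖z.1 - z₀.1‖ ^ 2 + (z.2.1 - z₀.2.1) ^ 2 + (z.2.2 - z₀.2.2) ^ 2

lemma QQ_contDiff (z₀ : Dom n) : ContDiff ℝ 1 (QQ z₀) :=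
  contDiff_sep (a := fun x => ‖x - z₀.1‖ ^ 2) (b := fun y => (y - z₀.2.1) ^ 2)
    (d := fun t => (t - z₀.2.2) ^ 2)
    ((contDiff_id.sub contDiff_const).norm_sq ℝ) (by fun_prop) (by fun_prop)

lemma QQ_self (z₀ : Dom n) : QQ z₀ z₀ = 0 := by simp [QQ]

lemma QQ_nonneg (z₀ z : Dom n) : 0 ≤ QQ z₀ z := by unfold QQ; positivity

lemma QQ_fderiv (z₀ : Dom n) : fderiv ℝ (QQ z₀) z₀ = 0 := by
  apply IsLocalMin.fderiv_eq_zero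
  filter_upwards with z
  rw [QQ_self]; exact QQ_nonneg _ _

lemma QQ_ge {z₀ z : Dom n} {r : ℝ} (hr : 0 ≤ r) (h : r ≤ dist z z₀) : r ^ 2 ≤ QQ z₀ z := by
  unfold QQ
  simp only [Prod.dist_eq, le_max_iff, Real.dist_eq, dist_eq_norm z.1] at h
  rcases h with h | h | h
  · have := pow_le_pow_left₀ hr h 2
    nlinarith [sq_nonneg (z.2.1 - z₀.2.1), sq_nonneg (z.2.2 - z₀.2.2)]
  · have := pow_le_pow_left₀ hr h 2
    rw [sq_abs] at this
    nlinarith [sq_nonneg ‖z.1 - z₀.1‖, sq_nonneg (z.2.2 - z₀.2.2)]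
  · have := pow_le_pow_left₀ hr h 2
    rw [sq_abs] at this
    nlinarith [sq_nonneg (z.2.1 - z₀.2.1), sq_nonneg ‖z.1 - z₀.1‖]

lemma FF_add_QQ (G : Ham n) {φ : Dom n → ℝ} (hφ : ContDiff ℝ 1 φ) (z₀ : Dom n) (s k : ℝ) :
    FF G (fun z => φ z + s * QQ z₀ z + k) z₀ = FF G φ z₀ := by
  apply FF_congr
  have hq := ((QQ_contDiff z₀).differentiable (by norm_num) z₀).hasFDerivAt
  rw [QQ_fderiv] at hq
  have h := (((hφ.differentiable (by norm_num) z₀).hasFDerivAt.add (hq.const_mul s)).add_const k)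
  have := h.fderiv
  simpa using this

lemma dist_t_le (z z₀ : Dom n) : |z.2.2 - z₀.2.2| ≤ dist z z₀ := by
  rw [← Real.dist_eq]
  exact (le_max_right _ _).trans (le_max_right _ _)

/-- stability of subsolutions under suprema -/
lemma visc_sub_sup {G : Ham n} (h1 : HypH1 G) (S : Set (Dom n → ℝ))
    (hS : ∀ u ∈ S, UpperSemicontinuous u ∧ ViscSubPos G u) {V : Dom n → ℝ}
    (hV : ∀ u ∈ S, ∀ z, u z ≤ V z)
    (hap : ∀ z, ∀ b < V z, ∃ᶠ w in 𝓝 z, ∃ u ∈ S, b < u w) : ViscSubPos G V := by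
  intro φ hφ z₀ ht hmax
  by_contra hcon
  push Not at hcon
  set ψ : Dom n → ℝ := fun z => φ z + 1 * QQ z₀ z + 0 with hψ
  have hψc : ContDiff ℝ 1 ψ := by
    have := QQ_contDiff z₀
    fun_prop
  have hF : 0 < FF G ψ z₀ := by rw [hψ, FF_add_QQ G hφ]; exact hcon
  have hev : ∀ᶠ z in 𝓝 z₀, 0 < FF G ψ z ∧ V z - φ z ≤ V z₀ - φ z₀ :=
    (((FF_cont h1 hψc).tendsto z₀).eventually (lt_mem_nhds hF)).and hmax
  obtain ⟨r₀, hr₀, hball⟩ := Metric.eventually_nhds_iff.1 hev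
  set r := min (r₀ / 2) (z₀.2.2 / 2) with hr
  have hr0 : 0 < r := by positivity
  have hrr : r < r₀ := (min_le_left _ _).trans_lt (by linarith)
  have hrt : r < z₀.2.2 := (min_le_right _ _).trans_lt (by linarith)
  -- a point where some member of the family is large
  have hnear : ∀ᶠ w in 𝓝 z₀, ψ w < ψ z₀ + r ^ 2 / 2 ∧ dist w z₀ < r :=
    ((hψc.continuous.tendsto z₀).eventually
      (eventually_lt_nhds (b := ψ z₀ + r ^ 2 / 2) (by linarith [sq_pos_of_pos hr0]))).and
      (Metric.ball_mem_nhds z₀ hr0)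
  obtain ⟨z₁, ⟨u, huS, hu⟩, hz₁, hz₁r⟩ := ((hap z₀ (V z₀ - r ^ 2 / 2)
    (by linarith [sq_pos_of_pos hr0])).and_eventually hnear).exists
  have husc : UpperSemicontinuousOn (fun z => u z + (- ψ z)) (Metric.closedBall z₀ r) :=
    ((hS u huS).1.add hψc.continuous.neg.upperSemicontinuous).upperSemicontinuousOn _
  obtain ⟨z₂, hz₂, hm⟩ := husc.exists_isMaxOn ⟨z₁, hz₁r.le⟩ (isCompact_closedBall z₀ r)
  have hm1 : u z₁ + (- ψ z₁) ≤ u z₂ + (- ψ z₂) := hm (a := z₁) hz₁r.le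
  have hz₂' : dist z₂ z₀ ≤ r := hz₂
  have hb2 := hball (lt_of_le_of_lt hz₂' hrr)
  have hψ0 : ψ z₀ = φ z₀ := by simp [hψ, QQ_self]
  have hψ2 : ψ z₂ = φ z₂ + QQ z₀ z₂ := by simp [hψ]
  have hlt : dist z₂ z₀ < r := by
    refine lt_of_le_of_ne hz₂' (fun h => ?_)
    have := QQ_ge hr0.le h.ge
    linarith [hb2.2, hV u huS z₂]
  have hlm : IsLocalMax (fun w => u w - ψ w) z₂ := by
    filter_upwards [Metric.isOpen_ball.mem_nhds hlt] with w hw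
    have : u w + (- ψ w) ≤ u z₂ + (- ψ z₂) := hm (a := w) (Metric.ball_subset_closedBall hw)
    linarith
  have hpos : 0 < z₂.2.2 := by
    linarith [(abs_le.1 (dist_t_le z₂ z₀)).1]
  have := (hS u huS).2 ψ hψc z₂ hpos hlm
  have h' := hb2.1
  unfold FF at h'
  linarith

/-- admissible barrier data -/
def Bar (G : Ham n) (v₀ : Dom2 n → ℝ) (q₀ : Dom2 n) (ε K C : ℝ) : Prop :=
  0 ≤ K ∧ (∀ q, |v₀ q - v₀ q₀| ≤ ε + K * (LgE (q.1 - q₀.1) + Lg (q.2 - q₀.2))) ∧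
  ∀ x y t px py, ‖px‖ ≤ K → |py| ≤ K → |G x y t px py| ≤ C

/-- the barrier function -/
def wb (v₀ : Dom2 n → ℝ) (s : ℝ) (q₀ : Dom2 n) (ε K C : ℝ) (z : Dom n) : ℝ :=
  v₀ q₀ + s * (ε + K * (LgE (z.1 - q₀.1) + Lg (z.2.1 - q₀.2)) + C * |z.2.2|)

lemma wb_cont (v₀ : Dom2 n → ℝ) (s : ℝ) (q₀ : Dom2 n) (ε K C : ℝ) : Continuous (wb v₀ s q₀ ε K C) := by
  have := Lg_cont
  have := LgE_cont (n := n)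
  unfold wb
  fun_prop

lemma Bar.C_nonneg {G : Ham n} {v₀ : Dom2 n → ℝ} {q₀ : Dom2 n} {ε K C : ℝ} (h : Bar G v₀ q₀ ε K C) :
    0 ≤ C := (abs_nonneg _).trans (h.2.2 0 0 0 0 0 (by simpa using h.1) (by simpa using h.1))

lemma Bar.le_wb {G : Ham n} {v₀ : Dom2 n → ℝ} {q₀ : Dom2 n} {ε K C : ℝ} (h : Bar G v₀ q₀ ε K C)
    (z : Dom n) : v₀ (z.1, z.2.1) + C * |z.2.2| ≤ wb v₀ 1 q₀ ε K C z := by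
  have := (abs_le.1 (h.2.1 (z.1, z.2.1))).2
  unfold wb
  simp only at this
  linarith

lemma Bar.wb_le {G : Ham n} {v₀ : Dom2 n → ℝ} {q₀ : Dom2 n} {ε K C : ℝ} (h : Bar G v₀ q₀ ε K C)
    (z : Dom n) : wb v₀ (-1) q₀ ε K C z ≤ v₀ (z.1, z.2.1) - C * |z.2.2| := by
  have := (abs_le.1 (h.2.1 (z.1, z.2.1))).1
  unfold wb
  simp only at this
  linarith

lemma bar_exists {G : Ham n} (h1 : HypH1 G) {v₀ : Dom2 n → ℝ} (hb : ∃ M, ∀ q, |v₀ q| ≤ M)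
    (huc : UniformContinuous v₀) (ε : ℝ) (hε : 0 < ε) : ∃ K C, ∀ q₀, Bar G v₀ q₀ ε K C := by
  obtain ⟨M, hM⟩ := hb
  have hM0 : 0 ≤ M := (abs_nonneg _).trans (hM 0)
  obtain ⟨ρ, hρ, h⟩ := Metric.uniformContinuous_iff.1 huc ε hε
  have hl : 0 < Lg ρ := Real.log_pos (by nlinarith [sq_pos_of_pos hρ])
  set K := 2 * M / Lg ρ with hK
  have hK0 : 0 ≤ K := by positivity
  obtain ⟨C, hC⟩ := G_bdd h1 K
  refine ⟨K, C, fun q₀ => ⟨hK0, fun q => ?_, hC⟩⟩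
  have n1 := LgE_nonneg (q.1 - q₀.1)
  have n2 := Lg_nonneg (q.2 - q₀.2)
  by_cases hd : dist q q₀ < ρ
  · have := h hd
    rw [Real.dist_eq] at this
    have : 0 ≤ K * (LgE (q.1 - q₀.1) + Lg (q.2 - q₀.2)) := by positivity
    linarith
  · have e1 : |v₀ q - v₀ q₀| ≤ 2 * M := by
      refine (abs_sub _ _).trans ?_
      linarith [hM q, hM q₀]
    have e2 : Lg ρ ≤ LgE (q.1 - q₀.1) + Lg (q.2 - q₀.2) := by
      rw [not_lt, Prod.dist_eq, le_max_iff, Real.dist_eq, dist_eq_norm] at hd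
      rcases hd with hd | hd
      · have : Lg ρ ≤ LgE (q.1 - q₀.1) := by
          unfold Lg LgE
          apply Real.log_le_log (by positivity)
          gcongr
        linarith
      · have : Lg ρ ≤ Lg (q.2 - q₀.2) := by
          unfold Lg
          apply Real.log_le_log (by positivity)
          rw [← sq_abs (q.2 - q₀.2)]
          gcongr
        linarith
    have e3 : K * Lg ρ = 2 * M := by rw [hK]; field_simp
    have := mul_le_mul_of_nonneg_left e2 hK0
    linarith

lemma extr_pd {f u χ : Dom n → ℝ} {z : Dom n} {px : Euc n} {py pt : ℝ}
    (hf : HasFDerivAt f (clm px py pt) z) (hu : u =ᶠ[𝓝 z] f) (hχ : ContDiff ℝ 1 χ)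
    (h : IsLocalExtr (fun w => u w - χ w) z) : pdX χ z = px ∧ pdY χ z = py ∧ pdT χ z = pt := by
  have hχ' := (hχ.differentiable (by norm_num) z).hasFDerivAt
  have hd : HasFDerivAt (fun w => u w - χ w) (clm px py pt - fderiv ℝ χ z) z :=
    (hf.congr_of_eventuallyEq hu).sub hχ'
  have h0 := h.hasFDerivAt_eq_zero hd
  rw [sub_eq_zero] at h0
  apply pd_of_hasFDerivAt
  rw [← h0] at hχ'
  exact hχ'

lemma wb_extr {v₀ : Dom2 n → ℝ} {s : ℝ} {q₀ : Dom2 n} {ε K C : ℝ} {χ : Dom n → ℝ} (hχ : ContDiff ℝ 1 χ)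
    {z : Dom n} (hz : 0 < z.2.2) (h : IsLocalExtr (fun w => wb v₀ s q₀ ε K C w - χ w) z) :
    pdX χ z = (s * K) • dLgE (z.1 - q₀.1) ∧ pdY χ z = (s * K) * dLg (z.2.1 - q₀.2) ∧ pdT χ z = s * C := by
  have g1 : HasGradientAt (fun x => (s * K) * LgE (x - q₀.1)) ((s * K) • dLgE (z.1 - q₀.1)) z.1 := by
    have e2 := LgE_hasGrad (z.1 - q₀.1)
    rw [hasGradientAt_iff_hasFDerivAt] at *
    have e3 := HasFDerivAt.comp z.1 e2 ((hasFDerivAt_id z.1).sub_const q₀.1)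
    refine (e3.const_mul (s * K)).congr_fderiv ?_
    ext; simp
  have g2 : HasDerivAt (fun y => (s * K) * Lg (y - q₀.2)) ((s * K) * dLg (z.2.1 - q₀.2)) z.2.1 := by
    have e := (Lg_hasDeriv (z.2.1 - q₀.2)).comp z.2.1 ((hasDerivAt_id z.2.1).sub_const q₀.2)
    exact (e.const_mul (s * K)).congr_deriv (by ring)
  have g3 : HasDerivAt (fun t => (v₀ q₀ + s * ε) + (s * C) * t) (s * C) z.2.2 := by
    exact (((hasDerivAt_id z.2.2).const_mul (s * C)).const_add _).congr_deriv (by ring)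
  refine extr_pd (pd_sep g1 g2 g3) ?_ hχ h
  have hc : Continuous (fun z : Dom n => z.2.2) := by fun_prop
  filter_upwards [hc.continuousAt.eventually (lt_mem_nhds hz)] with w hw
  unfold wb
  rw [abs_of_pos hw]
  ring

lemma wb_p {K s : ℝ} (hK : 0 ≤ K) (hs : |s| = 1) (x : Euc n) (y : ℝ) :
    ‖(s * K) • dLgE x‖ ≤ K ∧ |s * K * dLg y| ≤ K := by
  constructor
  · rw [norm_smul, Real.norm_eq_abs, abs_mul, hs, one_mul, abs_of_nonneg hK]
    exact mul_le_of_le_one_right hK (dLgE_norm x)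
  · rw [abs_mul, abs_mul, hs, one_mul, abs_of_nonneg hK]
    exact mul_le_of_le_one_right hK (dLg_abs y)

lemma wb_super {G : Ham n} {v₀ : Dom2 n → ℝ} {q₀ : Dom2 n} {ε K C : ℝ} (h : Bar G v₀ q₀ ε K C) :
    ViscSuperPos G (wb v₀ 1 q₀ ε K C) := by
  intro χ hχ z hz hm
  obtain ⟨a, b, c⟩ := wb_extr hχ hz (Or.inl hm)
  rw [a, b, c]
  have hp := wb_p h.1 (s := 1) (by simp) (z.1 - q₀.1) (z.2.1 - q₀.2)
  have := (abs_le.1 (h.2.2 z.1 z.2.1 z.2.2 _ _ hp.1 hp.2)).1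
  linarith

lemma wb_sub {G : Ham n} {v₀ : Dom2 n → ℝ} {q₀ : Dom2 n} {ε K C : ℝ} (h : Bar G v₀ q₀ ε K C) :
    ViscSubPos G (wb v₀ (-1) q₀ ε K C) := by
  intro χ hχ z hz hm
  obtain ⟨a, b, c⟩ := wb_extr hχ hz (Or.inr hm)
  rw [a, b, c]
  have hp := wb_p h.1 (s := -1) (by simp) (z.1 - q₀.1) (z.2.1 - q₀.2)
  have := (abs_le.1 (h.2.2 z.1 z.2.1 z.2.2 _ _ hp.1 hp.2)).2
  linarith

end PartE

section PartF

/-! ### Part F: Perron's method -/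

variable {n : ℕ}

lemma bump {G : Ham n} (h1 : HypH1 G) {v vl : Dom n → ℝ} (husc : UpperSemicontinuous v)
    (hsub : ViscSubPos G v) (hle : ∀ z, vl z ≤ v z)
    (hap : ∀ z, ∀ b > vl z, ∃ᶠ w in 𝓝 z, v w < b)
    (hmaxi : ∀ U : Dom n → ℝ, UpperSemicontinuous U → ViscSubPos G U →
      (∃ τ > 0, ∀ z : Dom n, z.2.2 ≤ τ → U z = v z) → (∃ B, ∀ z, U z ≤ v z + B) → ∀ z, U z ≤ v z) :
    ViscSuperPos G vl := by
  classical
  intro φ hφ z₀ ht hmin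
  by_contra hcon
  push Not at hcon
  set ψ : Dom n → ℝ := fun z => φ z + (-1) * QQ z₀ z + (vl z₀ - φ z₀) with hψ
  have hψc : ContDiff ℝ 1 ψ := by
    have := QQ_contDiff z₀
    fun_prop
  have hψ0 : ψ z₀ = vl z₀ := by simp [hψ, QQ_self]
  have hF : FF G ψ z₀ < 0 := by rw [hψ, FF_add_QQ G hφ]; exact hcon
  have hev : ∀ᶠ z in 𝓝 z₀, FF G ψ z < 0 ∧ vl z₀ - φ z₀ ≤ vl z - φ z :=
    (((FF_cont h1 hψc).tendsto z₀).eventually (gt_mem_nhds hF)).and hmin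
  obtain ⟨r₀, hr₀, hball⟩ := Metric.eventually_nhds_iff.1 hev
  set r := min (r₀ / 2) (z₀.2.2 / 2) with hr
  have hr0 : 0 < r := by positivity
  have hrr : r < r₀ := (min_le_left _ _).trans_lt (by linarith)
  have hrt : r ≤ z₀.2.2 / 2 := min_le_right _ _
  set κ := r ^ 2 / 8 with hκ
  have hκ0 : 0 < κ := by positivity
  have hlow : ∀ z, dist z z₀ < r → ψ z + QQ z₀ z ≤ vl z := by
    intro z hz
    have := (hball (hz.trans hrr)).2
    simp only [hψ]
    linarith
  set U : Dom n → ℝ := fun z => if dist z z₀ < r then max (v z) (ψ z + κ) else v z with hU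
  have hUv : ∀ z, v z ≤ U z := by
    intro z
    simp only [hU]
    split_ifs
    · exact le_max_left _ _
    · exact le_rfl
  have hU2 : ∀ z, r / 2 < dist z z₀ → U z = v z := by
    intro z hz
    simp only [hU]
    split_ifs with h
    · apply max_eq_left
      have q := QQ_ge (by positivity) hz.le
      have := hlow z h
      have := hle z
      have e : (r / 2) ^ 2 = 2 * κ := by rw [hκ]; ring
      linarith
    · rfl
  have hUusc : UpperSemicontinuous U := by
    intro z b hb
    by_cases hz : dist z z₀ < r
    · have hmx : UpperSemicontinuous (fun z => max (v z) (ψ z + κ)) :=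
        husc.sup (hψc.continuous.add continuous_const).upperSemicontinuous
      have hb' : max (v z) (ψ z + κ) < b := by simpa only [hU, if_pos hz] using hb
      filter_upwards [hmx z b hb', Metric.isOpen_ball.mem_nhds hz] with w hw hw2
      have hw2' : dist w z₀ < r := hw2
      simpa only [hU, if_pos hw2'] using hw
    · have hz' : r / 2 < dist z z₀ := by linarith
      rw [hU2 z hz'] at hb
      have hc : Continuous (fun w : Dom n => dist w z₀) := by fun_prop
      filter_upwards [husc z b hb, hc.continuousAt.eventually (lt_mem_nhds hz')] with w hw hw2
      rw [hU2 w hw2]; exact hw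
  have hUsub : ViscSubPos G U := by
    intro χ hχ z hz hm
    by_cases he : U z = v z
    · apply hsub χ hχ z hz
      filter_upwards [hm] with w hw
      linarith [hUv w]
    · have hzr : dist z z₀ < r := by
        by_contra hz2
        exact he (by simp only [hU, if_neg hz2])
      have hUz : U z = ψ z + κ := by
        have : U z = max (v z) (ψ z + κ) := by simp only [hU, if_pos hzr]
        rcases max_choice (v z) (ψ z + κ) with h | h
        · exact absurd (this.trans h) he
        · exact this.trans h
      have hlm : IsLocalMax (fun w => ψ w - χ w) z := by
        filter_upwards [hm, Metric.isOpen_ball.mem_nhds hzr] with w hw hw2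
        have hw2' : dist w z₀ < r := hw2
        have : ψ w + κ ≤ U w := by
          simp only [hU, if_pos hw2']; exact le_max_right _ _
        linarith
      have hd := hlm.hasFDerivAt_eq_zero ((hψc.differentiable (by norm_num) z).hasFDerivAt.sub
        (hχ.differentiable (by norm_num) z).hasFDerivAt)
      rw [sub_eq_zero] at hd
      have := (hball (hzr.trans hrr)).1
      rw [FF_congr G hd] at this
      exact this.le
  have hfin := hmaxi U hUusc hUsub ⟨z₀.2.2 / 4, by positivity, fun z hz => ?_⟩ ⟨κ, fun z => ?_⟩
  · have hnear : ∀ᶠ w in 𝓝 z₀, ψ z₀ - κ / 2 < ψ w ∧ dist w z₀ < r :=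
      ((hψc.continuous.tendsto z₀).eventually (lt_mem_nhds (by linarith))).and
        (Metric.ball_mem_nhds z₀ hr0)
    obtain ⟨w, hw, hw1, hw2⟩ := ((hap z₀ (vl z₀ + κ / 2) (by linarith)).and_eventually hnear).exists
    have h3 := hfin w
    have : ψ w + κ ≤ U w := by
      simp only [hU, if_pos hw2]; exact le_max_right _ _
    linarith
  · apply hU2
    have := (abs_le.1 (dist_t_le z z₀)).1
    linarith
  · simp only [hU]
    split_ifs with h
    · apply max_le
      · linarith
      · linarith [hlow z h, hle z, QQ_nonneg z₀ z]
    · linarith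

lemma wb_self (v₀ : Dom2 n → ℝ) (s ε K C : ℝ) (z : Dom n) :
    wb v₀ s (z.1, z.2.1) ε K C z = v₀ (z.1, z.2.1) + s * (ε + C * |z.2.2|) := by
  simp [wb, LgE, Lg]

theorem perron {G : Ham n} {C₁ C₂ l C₃ C₄ C₅ : ℝ} (h1 : HypH1 G) (h2 : HypH2 G C₁ C₂)
    (h3 : HypH3 G l C₃ C₄ C₅) {v₀ : Dom2 n → ℝ} (hb : ∃ M, ∀ q, |v₀ q| ≤ M)
    (huc : UniformContinuous v₀) : ∃ v, IVPSol G v₀ v := by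
  obtain ⟨M, hM⟩ := id hb
  have hbar := bar_exists h1 hb huc
  set S : Set (Dom n → ℝ) := {u | UpperSemicontinuous u ∧ ViscSubPos G u ∧
    ∀ q₀ ε K C, Bar G v₀ q₀ ε K C → ∀ z, u z ≤ wb v₀ 1 q₀ ε K C z} with hS
  obtain ⟨K1, B1, hB1⟩ := hbar 1 one_pos
  have hmem : ∀ q₀ ε K C, Bar G v₀ q₀ ε K C → wb v₀ (-1) q₀ ε K C ∈ S := by
    intro q₀ ε K C h
    refine ⟨(wb_cont _ _ _ _ _ _).upperSemicontinuous, wb_sub h, fun q₀' ε' K' C' h' z => ?_⟩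
    have a := h.wb_le z
    have b := h'.le_wb z
    have c := mul_nonneg h.C_nonneg (abs_nonneg z.2.2)
    have d := mul_nonneg h'.C_nonneg (abs_nonneg z.2.2)
    linarith
  set v : Dom n → ℝ := fun z => sSup ((fun u : Dom n → ℝ => u z) '' S) with hv
  have hne : ∀ z, ((fun u : Dom n → ℝ => u z) '' S).Nonempty := fun z =>
    ⟨_, _, hmem 0 1 K1 B1 (hB1 0), rfl⟩
  have hbd : ∀ z, BddAbove ((fun u : Dom n → ℝ => u z) '' S) := by
    intro z
    refine ⟨wb v₀ 1 0 1 K1 B1 z, ?_⟩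
    rintro _ ⟨u, hu, rfl⟩
    exact hu.2.2 _ _ _ _ (hB1 0) z
  have hle : ∀ u ∈ S, ∀ z, u z ≤ v z := fun u hu z => le_csSup (hbd z) ⟨u, hu, rfl⟩
  have hvw : ∀ q₀ ε K C, Bar G v₀ q₀ ε K C → ∀ z, v z ≤ wb v₀ 1 q₀ ε K C z := by
    intro q₀ ε K C h z
    apply csSup_le (hne z)
    rintro _ ⟨u, hu, rfl⟩
    exact hu.2.2 _ _ _ _ h z
  have hwc := wb_cont v₀ 1 0 1 K1 B1
  have hvS' : uenv v ∈ S := by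
    refine ⟨uenv_usc hwc (hvw _ _ _ _ (hB1 0)), ?_, ?_⟩
    · refine visc_sub_sup h1 S (fun u hu => ⟨hu.1, hu.2.1⟩) (fun u hu z =>
        (hle u hu z).trans (le_uenv hwc (hvw _ _ _ _ (hB1 0)) z)) (fun z b hb => ?_)
      refine (uenv_approx v z hb).mono fun w hw => ?_
      obtain ⟨_, ⟨u, hu, rfl⟩, h⟩ := exists_lt_of_lt_csSup (hne w) hw
      exact ⟨u, hu, h⟩
    · intro q₀ ε K C h z
      exact uenv_le_cont (wb_cont _ _ _ _ _ _) (hvw _ _ _ _ h) z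
  have hveq : uenv v = v := funext fun z =>
    le_antisymm (hle _ hvS' z) (le_uenv hwc (hvw _ _ _ _ (hB1 0)) z)
  have hvS : v ∈ S := hveq ▸ hvS'
  clear hvS' hveq
  -- lower envelope
  have hnegw : ∀ q₀ ε K C, Bar G v₀ q₀ ε K C → ∀ z, - v z ≤ - wb v₀ (-1) q₀ ε K C z :=
    fun q₀ ε K C h z => neg_le_neg (hle _ (hmem _ _ _ _ h) z)
  have hwc' : ∀ q₀ ε K C, Continuous (fun z => - wb v₀ (-1) q₀ ε K C z) :=
    fun q₀ ε K C => (wb_cont v₀ (-1) q₀ ε K C).neg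
  set vl : Dom n → ℝ := fun z => - uenv (fun z => - v z) z with hvl
  have hvlv : ∀ z, vl z ≤ v z := fun z => by
    have := le_uenv (hwc' _ _ _ _) (hnegw _ _ _ _ (hB1 0)) z
    simp only [hvl]; linarith
  have hvlw : ∀ q₀ ε K C, Bar G v₀ q₀ ε K C → ∀ z, wb v₀ (-1) q₀ ε K C z ≤ vl z := by
    intro q₀ ε K C h z
    have := uenv_le_cont (hwc' _ _ _ _) (hnegw _ _ _ _ h) z
    simp only [hvl]; linarith
  have hvllsc : LowerSemicontinuous vl := by
    have := uenv_usc (hwc' _ _ _ _) (hnegw _ _ _ _ (hB1 0))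
    exact continuous_neg.comp_upperSemicontinuous_antitone this (fun a b h => neg_le_neg h)
  -- bounds
  have hup : ∀ ε > 0, ∃ C, 0 ≤ C ∧ ∀ z, v z ≤ v₀ (z.1, z.2.1) + (ε + C * |z.2.2|) ∧
      v₀ (z.1, z.2.1) - (ε + C * |z.2.2|) ≤ vl z := by
    intro ε hε
    obtain ⟨K, C, hKC⟩ := hbar ε hε
    refine ⟨C, (hKC 0).C_nonneg, fun z => ⟨?_, ?_⟩⟩
    · have := hvw _ _ _ _ (hKC (z.1, z.2.1)) z
      rw [wb_self] at this
      linarith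
    · have := hvlw _ _ _ _ (hKC (z.1, z.2.1)) z
      rw [wb_self] at this
      linarith
  have hsm : ∀ ε > 0, ∃ ρ > 0, ∀ z : Dom n, 0 ≤ z.2.2 → z.2.2 ≤ ρ → v z ≤ v₀ (z.1, z.2.1) + ε ∧
      v₀ (z.1, z.2.1) - ε ≤ vl z := by
    intro ε hε
    obtain ⟨C, hC, h⟩ := hup (ε / 2) (by positivity)
    obtain ⟨ρ, hρ, hρ'⟩ := exists_small C (ε / 2) (by positivity) hC
    refine ⟨ρ, hρ, fun z hz hz' => ?_⟩
    have a := h z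
    have b := hρ' _ hz hz'
    rw [abs_of_nonneg hz] at a
    constructor <;> linarith [a.1, a.2]
  have hbds : ∀ T : ℝ, 0 < T → ∃ A, ∀ z ∈ slab n T, v z ≤ A ∧ -A ≤ vl z := by
    intro T hT
    obtain ⟨C, hC, h⟩ := hup 1 one_pos
    refine ⟨M + (1 + C * T), fun z hz => ?_⟩
    have a := h z
    have b := abs_le.1 (hM (z.1, z.2.1))
    rw [abs_of_nonneg hz.1] at a
    have := mul_le_mul_of_nonneg_left hz.2 hC
    constructor <;> linarith [a.1, a.2]
  have hvlsuper : ViscSuperPos G vl := by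
    refine bump h1 hvS.1 hvS.2.1 hvlv (fun z b hb => ?_) ?_
    · refine (uenv_approx (fun z => - v z) z (b := -b) (by simp only [hvl] at hb; linarith)).mono fun w hw => ?_
      linarith
    · rintro U hUusc hUsub ⟨τ, hτ, hUτ⟩ ⟨B, hB⟩
      refine hle U ⟨hUusc, hUsub, fun q₀ ε K C h z => ?_⟩
      by_cases hz : z.2.2 ≤ τ
      · rw [hUτ z hz]; exact hvw _ _ _ _ h z
      push Not at hz
      refine le_of_forall_pos_le_add fun e he => ?_
      have hlow : ∀ z : Dom n, v₀ (z.1, z.2.1) ≤ wb v₀ 1 q₀ ε K C z := fun z => by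
        linarith [h.le_wb z, mul_nonneg h.C_nonneg (abs_nonneg z.2.2)]
      obtain ⟨ρ, hρ, hc⟩ := strong_comparison h1 h2 h3 hUsub (wb_super h) (hUusc.upperSemicontinuousOn _)
        ((wb_cont v₀ 1 q₀ ε K C).lowerSemicontinuous.lowerSemicontinuousOn _)
        (fun T hT => by
          obtain ⟨A, hA⟩ := hbds T hT
          exact ⟨A + B, fun z hz => (hB z).trans (by linarith [(hA z hz).1])⟩)
        (fun T hT => ⟨M, fun z hz => (abs_le.1 (hM (z.1, z.2.1))).1.trans (hlow z)⟩) huc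
        (fun ε hε => by
          obtain ⟨ρ, hρ, h⟩ := hsm ε hε
          refine ⟨min ρ τ, by positivity, fun z hz hz' => ?_⟩
          rw [hUτ z (hz'.trans (min_le_right _ _))]
          exact (h z hz (hz'.trans (min_le_left _ _))).1)
        (fun ε hε => ⟨1, one_pos, fun z _ _ => by linarith [hlow z]⟩) z.2.2 (hτ.trans hz) e he
      exact hc z ⟨(hτ.trans hz).le, le_rfl⟩ z ⟨(hτ.trans hz).le, le_rfl⟩ (by simpa using hρ.le)
  have hcomp := strong_comparison h1 h2 h3 hvS.2.1 hvlsuper (hvS.1.upperSemicontinuousOn _)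
    (hvllsc.lowerSemicontinuousOn _)
    (fun T hT => by
      obtain ⟨A, hA⟩ := hbds T hT
      exact ⟨A, fun z hz => (hA z hz).1⟩)
    (fun T hT => by
      obtain ⟨A, hA⟩ := hbds T hT
      exact ⟨A, fun z hz => (hA z hz).2⟩) huc
    (fun ε hε => by
      obtain ⟨ρ, hρ, h⟩ := hsm ε hε
      exact ⟨ρ, hρ, fun z a b => (h z a b).1⟩)
    (fun ε hε => by
      obtain ⟨ρ, hρ, h⟩ := hsm ε hε
      exact ⟨ρ, hρ, fun z a b => (h z a b).2⟩)
  have heq : ∀ z : Dom n, 0 ≤ z.2.2 → v z = vl z := by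
    intro z hz
    refine le_antisymm (le_of_forall_pos_le_add fun e he => ?_) (hvlv z)
    obtain ⟨ρ, hρ, h⟩ := hcomp (z.2.2 + 1) (by linarith) e he
    exact h z ⟨hz, by linarith⟩ z ⟨hz, by linarith⟩ (by simpa using hρ.le)
  have hUC : ∀ T : ℝ, 0 < T → UniformContinuousOn v {z : Dom n | 0 ≤ z.2.2 ∧ z.2.2 ≤ T} := by
    intro T hT
    rw [Metric.uniformContinuousOn_iff]
    intro ε hε
    obtain ⟨ρ, hρ, h⟩ := hcomp T hT (ε / 2) (by positivity)
    refine ⟨ρ, hρ, fun z hz z' hz' hd => ?_⟩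
    have a := h z hz z' hz' hd.le
    have b := h z' hz' z hz (by rw [dist_comm]; exact hd.le)
    rw [Real.dist_eq, abs_lt]
    rw [← heq z' hz'.1] at a
    rw [← heq z hz.1] at b
    constructor <;> linarith
  have hsuper : ViscSuperPos G v := by
    intro φ hφ z hz hm
    refine hvlsuper φ hφ z hz ?_
    have hc : Continuous (fun z : Dom n => z.2.2) := by fun_prop
    filter_upwards [hm, hc.continuousAt.eventually (lt_mem_nhds hz)] with w hw hw2
    rw [← heq w hw2.le, ← heq z hz.le]
    exact hw
  refine ⟨v, ?_, fun x y => ?_, hvS.2.1, hsuper, fun T hT => ⟨?_, hUC T hT⟩⟩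
  · intro z hz
    have h := (hUC (z.2.2 + 1) (by linarith [show 0 ≤ z.2.2 from hz])).continuousOn z
      ⟨hz, by linarith⟩
    refine h.mono_of_mem_nhdsWithin ?_
    have hc : Continuous (fun z : Dom n => z.2.2) := by fun_prop
    have := hc.continuousAt.eventually (gt_mem_nhds (show z.2.2 < z.2.2 + 1 by linarith))
    filter_upwards [self_mem_nhdsWithin, nhdsWithin_le_nhds this] with w hw hw2
    exact ⟨hw, hw2.le⟩
  · refine le_antisymm (le_of_forall_pos_le_add fun e he => ?_) (le_of_forall_pos_le_add fun e he => ?_)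
    · obtain ⟨ρ, hρ, h⟩ := hsm e he
      exact (h (x, y, 0) le_rfl hρ.le).1
    · obtain ⟨ρ, hρ, h⟩ := hsm e he
      have := (h (x, y, 0) le_rfl hρ.le).2
      linarith [hvlv (x, y, 0)]
  · obtain ⟨A, hA⟩ := hbds T hT
    refine ⟨A, fun z a b => ?_⟩
    rw [abs_le]
    have := hA z ⟨a, b⟩
    exact ⟨this.2.trans (hvlv z), this.1⟩

end PartF

section PartH

/-! ### Part H: uniqueness and large time behaviour -/

variable {n : ℕ}

lemma pd_add_lin {φ : Dom n → ℝ} (hφ : ContDiff ℝ 1 φ) (s : ℝ) (z : Dom n) :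
    pdX (fun z => φ z + s * z.2.2) z = pdX φ z ∧ pdY (fun z => φ z + s * z.2.2) z = pdY φ z ∧
    pdT (fun z => φ z + s * z.2.2) z = pdT φ z + s := by
  have h1 := (hφ.differentiable (by norm_num) z).hasFDerivAt
  have h2 : HasFDerivAt (fun z : Dom n => z.2.2)
      ((ContinuousLinearMap.snd ℝ ℝ ℝ).comp (ContinuousLinearMap.snd ℝ (Euc n) (ℝ × ℝ))) z :=
    ((ContinuousLinearMap.snd ℝ ℝ ℝ).comp (ContinuousLinearMap.snd ℝ (Euc n) (ℝ × ℝ))).hasFDerivAt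
  have h := (h1.add (h2.const_mul s)).fderiv
  have h' : fderiv ℝ (fun z => φ z + s * z.2.2) z = fderiv ℝ φ z +
    s • ((ContinuousLinearMap.snd ℝ ℝ ℝ).comp (ContinuousLinearMap.snd ℝ (Euc n) (ℝ × ℝ))) := h
  refine ⟨?_, ?_, ?_⟩
  · ext i
    simp [pdX, h']
  · simp [pdY, h']
  · simp [pdT, h']

lemma sub_shift {G : Ham n} {lam : ℝ} {u : Dom n → ℝ} (hu : ViscSub G 0 lam u) (k : ℝ) :
    ViscSubPos G (fun z => u z - lam * z.2.2 + k) := by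
  intro φ hφ z hz hm
  have h := hu.2 (fun z => φ z + lam * z.2.2) (by fun_prop) z ?_
  · obtain ⟨a, b, c⟩ := pd_add_lin hφ lam z
    rw [a, b, c] at h
    linarith
  · filter_upwards [hm] with w hw
    linarith

lemma super_shift {G : Ham n} {lam : ℝ} {u : Dom n → ℝ} (hu : ViscSuper G 0 lam u) (k : ℝ) :
    ViscSuperPos G (fun z => u z - lam * z.2.2 + k) := by
  intro φ hφ z hz hm
  have h := hu.2 (fun z => φ z + lam * z.2.2) (by fun_prop) z ?_
  · obtain ⟨a, b, c⟩ := pd_add_lin hφ lam z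
    rw [a, b, c] at h
    linarith
  · filter_upwards [hm] with w hw
    linarith

lemma ivp_init {G : Ham n} {v₀ : Dom2 n → ℝ} {v : Dom n → ℝ} (hv : IVPSol G v₀ v) (ε : ℝ) (hε : 0 < ε) :
    ∃ ρ > 0, ∀ z : Dom n, 0 ≤ z.2.2 → z.2.2 ≤ ρ → |v z - v₀ (z.1, z.2.1)| ≤ ε := by
  obtain ⟨-, hi, -, -, hT⟩ := hv
  obtain ⟨ρ, hρ, h⟩ := Metric.uniformContinuousOn_iff.1 (hT 1 one_pos).2 ε hε
  refine ⟨min (ρ / 2) 1, by positivity, fun z hz hz' => ?_⟩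
  have := h z ⟨hz, hz'.trans (min_le_right _ _)⟩ (z.1, z.2.1, 0) ⟨le_rfl, zero_le_one⟩ (by
    simp only [Prod.dist_eq, dist_self, Real.dist_eq, sub_zero, abs_of_nonneg hz]
    exact max_lt hρ (max_lt hρ (hz'.trans_lt ((min_le_left _ _).trans_lt (by linarith)))))
  rw [hi, Real.dist_eq] at this
  exact this.le

/-- comparison of a general subsolution with the solution -/
lemma sub_le_ivp {G : Ham n} {C₁ C₂ l C₃ C₄ C₅ : ℝ} (h1 : HypH1 G) (h2 : HypH2 G C₁ C₂)
    (h3 : HypH3 G l C₃ C₄ C₅) {u v : Dom n → ℝ} {v₀ : Dom2 n → ℝ} (hv₀ : UniformContinuous v₀)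
    (hv : IVPSol G v₀ v) (hus : ViscSubPos G u) (hu : UpperSemicontinuousOn u {z | 0 ≤ z.2.2})
    (hub : ∀ T : ℝ, 0 < T → ∃ A, ∀ z ∈ slab n T, u z ≤ A)
    (hu0 : ∀ ε > 0, ∃ ρ > 0, ∀ z : Dom n, 0 ≤ z.2.2 → z.2.2 ≤ ρ → u z ≤ v₀ (z.1, z.2.1) + ε)
    (z : Dom n) (hz : 0 ≤ z.2.2) : u z ≤ v z := by
  refine le_of_forall_pos_le_add fun e he => ?_
  obtain ⟨ρ, hρ, h⟩ := strong_comparison h1 h2 h3 hus hv.2.2.2.1 hu hv.1.lowerSemicontinuousOn hub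
    (fun T hT => by
      obtain ⟨A, hA⟩ := (hv.2.2.2.2 T hT).1
      exact ⟨A, fun z hz => (abs_le.1 (hA z hz.1 hz.2)).1⟩) hv₀ hu0
    (fun ε hε => by
      obtain ⟨ρ, hρ, h⟩ := ivp_init hv ε hε
      exact ⟨ρ, hρ, fun z a b => by linarith [(abs_le.1 (h z a b)).1]⟩) (z.2.2 + 1) (by linarith) e he
  exact h z ⟨hz, by linarith⟩ z ⟨hz, by linarith⟩ (by simpa using hρ.le)

/-- comparison of the solution with a general supersolution -/
lemma ivp_le_super {G : Ham n} {C₁ C₂ l C₃ C₄ C₅ : ℝ} (h1 : HypH1 G) (h2 : HypH2 G C₁ C₂)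
    (h3 : HypH3 G l C₃ C₄ C₅) {u v : Dom n → ℝ} {v₀ : Dom2 n → ℝ} (hv₀ : UniformContinuous v₀)
    (hv : IVPSol G v₀ v) (hus : ViscSuperPos G u) (hu : LowerSemicontinuousOn u {z | 0 ≤ z.2.2})
    (hub : ∀ T : ℝ, 0 < T → ∃ A, ∀ z ∈ slab n T, -A ≤ u z)
    (hu0 : ∀ ε > 0, ∃ ρ > 0, ∀ z : Dom n, 0 ≤ z.2.2 → z.2.2 ≤ ρ → v₀ (z.1, z.2.1) - ε ≤ u z)
    (z : Dom n) (hz : 0 ≤ z.2.2) : v z ≤ u z := by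
  refine le_of_forall_pos_le_add fun e he => ?_
  obtain ⟨ρ, hρ, h⟩ := strong_comparison h1 h2 h3 hv.2.2.1 hus hv.1.upperSemicontinuousOn hu
    (fun T hT => by
      obtain ⟨A, hA⟩ := (hv.2.2.2.2 T hT).1
      exact ⟨A, fun z hz => (abs_le.1 (hA z hz.1 hz.2)).2⟩) hub hv₀
    (fun ε hε => by
      obtain ⟨ρ, hρ, h⟩ := ivp_init hv ε hε
      exact ⟨ρ, hρ, fun z a b => by linarith [(abs_le.1 (h z a b)).2]⟩) hu0 (z.2.2 + 1) (by linarith) e he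
  exact h z ⟨hz, by linarith⟩ z ⟨hz, by linarith⟩ (by simpa using hρ.le)

lemma ivp_le_ivp {G : Ham n} {C₁ C₂ l C₃ C₄ C₅ : ℝ} (h1 : HypH1 G) (h2 : HypH2 G C₁ C₂)
    (h3 : HypH3 G l C₃ C₄ C₅) {u v : Dom n → ℝ} {v₀ : Dom2 n → ℝ} (hv₀ : UniformContinuous v₀)
    (hv : IVPSol G v₀ v) (hu : IVPSol G v₀ u) (z : Dom n) (hz : 0 ≤ z.2.2) : u z ≤ v z := by
  refine sub_le_ivp h1 h2 h3 hv₀ hv hu.2.2.1 hu.1.upperSemicontinuousOn (fun T hT => ?_)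
    (fun ε hε => ?_) z hz
  · obtain ⟨A, hA⟩ := (hu.2.2.2.2 T hT).1
    exact ⟨A, fun z hz => (abs_le.1 (hA z hz.1 hz.2)).2⟩
  · obtain ⟨ρ, hρ, h⟩ := ivp_init hu ε hε
    exact ⟨ρ, hρ, fun z a b => by linarith [(abs_le.1 (h z a b)).2]⟩

lemma lam_bound {lam t T : ℝ} (h0 : 0 ≤ t) (h : t ≤ T) : |lam * t| ≤ |lam| * T := by
  rw [abs_mul, abs_of_nonneg h0]
  exact mul_le_mul_of_nonneg_left h (abs_nonneg _)

lemma large_time {G : Ham n} {C₁ C₂ l C₃ C₄ C₅ : ℝ} (h1 : HypH1 G) (h2 : HypH2 G C₁ C₂)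
    (h3 : HypH3 G l C₃ C₄ C₅) {v : Dom n → ℝ} {v₀ : Dom2 n → ℝ} (hv₀ : UniformContinuous v₀)
    (hb : ∃ M, ∀ q, |v₀ q| ≤ M)
    (hv : IVPSol G v₀ v) {lam : ℝ} (hlam : ErgodicConst G lam) :
    ∃ D, 0 ≤ D ∧ ∀ z : Dom n, 0 ≤ z.2.2 → |v z + lam * z.2.2| ≤ D := by
  obtain ⟨⟨u, ⟨Mu, hMu⟩, hu⟩, ⟨w, ⟨Mw, hMw⟩, hw⟩⟩ := hlam
  obtain ⟨M, hM⟩ := hb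
  have hlin : Continuous (fun z : Dom n => - (lam * z.2.2)) := by fun_prop
  have lo : ∀ z : Dom n, 0 ≤ z.2.2 → u z - lam * z.2.2 + (- Mu - M) ≤ v z := by
    refine sub_le_ivp h1 h2 h3 hv₀ hv (sub_shift hu (- Mu - M)) ?_ (fun T hT => ?_) (fun ε hε => ?_)
    · have : UpperSemicontinuous (fun z : Dom n => u z + - (lam * z.2.2) + (- Mu - M)) :=
        (hu.1.add hlin.upperSemicontinuous).add upperSemicontinuous_const
      simp only [← sub_eq_add_neg] at this
      exact this.upperSemicontinuousOn _
    · refine ⟨|lam| * T - M, fun z hz => ?_⟩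
      have := (abs_le.1 (lam_bound (lam := lam) hz.1 hz.2)).1
      linarith [(abs_le.1 (hMu z)).2]
    · obtain ⟨ρ, hρ, h⟩ := exists_small |lam| ε hε (abs_nonneg _)
      refine ⟨ρ, hρ, fun z a b => ?_⟩
      have e1 := (abs_le.1 (lam_bound (lam := lam) a b)).1
      have e2 := h ρ hρ.le le_rfl
      linarith [(abs_le.1 (hMu z)).2, (abs_le.1 (hM (z.1, z.2.1))).1]
  have hi : ∀ z : Dom n, 0 ≤ z.2.2 → v z ≤ w z - lam * z.2.2 + (Mw + M) := by
    refine ivp_le_super h1 h2 h3 hv₀ hv (super_shift hw (Mw + M)) ?_ (fun T hT => ?_) (fun ε hε => ?_)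
    · have : LowerSemicontinuous (fun z : Dom n => w z + - (lam * z.2.2) + (Mw + M)) :=
        (hw.1.add hlin.lowerSemicontinuous).add lowerSemicontinuous_const
      simp only [← sub_eq_add_neg] at this
      exact this.lowerSemicontinuousOn _
    · refine ⟨|lam| * T - M, fun z hz => ?_⟩
      have := (abs_le.1 (lam_bound (lam := lam) hz.1 hz.2)).2
      linarith [(abs_le.1 (hMw z)).1]
    · obtain ⟨ρ, hρ, h⟩ := exists_small |lam| ε hε (abs_nonneg _)
      refine ⟨ρ, hρ, fun z a b => ?_⟩
      have e1 := (abs_le.1 (lam_bound (lam := lam) a b)).2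
      have e2 := h ρ hρ.le le_rfl
      linarith [(abs_le.1 (hMw z)).1, (abs_le.1 (hM (z.1, z.2.1))).2]
  have p1 : 0 ≤ Mu := (abs_nonneg _).trans (hMu 0)
  have p2 : 0 ≤ Mw := (abs_nonneg _).trans (hMw 0)
  have p3 : 0 ≤ M := (abs_nonneg _).trans (hM 0)
  refine ⟨2 * Mu + 2 * Mw + M, by positivity, fun z hz => ?_⟩
  rw [abs_le]
  have a := lo z hz
  have b := hi z hz
  have c := abs_le.1 (hMu z)
  have d := abs_le.1 (hMw z)
  constructor <;> linarith

end PartH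

/-- Under (H1)–(H3), with λ̄ the ergodic constant, for every bounded
uniformly continuous initial datum v₀ there is a unique (bounded and uniformly
continuous on every slab ℝⁿ×ℝ×[0,T]) viscosity solution v of
`v_t + G(x,y,t,D_x v,D_y v) = 0` on ℝⁿ×ℝ×(0,∞) with `v(x,y,0) = v₀(x,y)`,
and `t⁻¹ v(x,y,t) → -λ̄` as `t → +∞` uniformly in (x,y). -/
theorem statement3 {n : ℕ} (hn : 0 < n) (G : Ham n) (C₁ C₂ l C₃ C₄ C₅ : ℝ)
    (h1 : HypH1 G) (h2 : HypH2 G C₁ C₂) (h3 : HypH3 G l C₃ C₄ C₅)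
    (lam : ℝ) (hlam : ErgodicConst G lam)
    (v₀ : Dom2 n → ℝ) (hv₀b : ∃ M, ∀ q, |v₀ q| ≤ M) (hv₀uc : UniformContinuous v₀) :
    ∃ v : Dom n → ℝ, IVPSol G v₀ v ∧
      (∀ v' : Dom n → ℝ, IVPSol G v₀ v' → ∀ z : Dom n, 0 ≤ z.2.2 → v' z = v z) ∧
      (∀ ε : ℝ, 0 < ε → ∃ T : ℝ, ∀ z : Dom n, T ≤ z.2.2 → |z.2.2⁻¹ * v z + lam| ≤ ε) := by
  obtain ⟨v, hv⟩ := perron h1 h2 h3 hv₀b hv₀uc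
  refine ⟨v, hv, fun v' hv' z hz => le_antisymm (ivp_le_ivp h1 h2 h3 hv₀uc hv hv' z hz)
    (ivp_le_ivp h1 h2 h3 hv₀uc hv' hv z hz), fun ε hε => ?_⟩
  obtain ⟨D, hD, h⟩ := large_time h1 h2 h3 hv₀uc hv₀b hv hlam
  refine ⟨D / ε + 1, fun z hz => ?_⟩
  have hDε : 0 ≤ D / ε := by positivity
  have ht : 0 < z.2.2 := by linarith
  have e : z.2.2⁻¹ * v z + lam = (v z + lam * z.2.2) / z.2.2 := by field_simp
  rw [e, abs_div, abs_of_pos ht, div_le_iff₀ ht]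
  refine (h z ht.le).trans ?_
  have : D / ε ≤ z.2.2 := by linarith
  rw [div_le_iff₀ hε] at this
  linarith
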